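/- For any planar tree t ∈ PT_n and any weight ω of length n: (a) the face lattice of the Loday realization P_{(t,ω)}, ordered by inclusion, is isomorphic to the dual of the lattice of nestings of t ordered by inclusion (with a maximal element added); under this correspondence the face of codimension k corresponding to a nesting 𝒩 with k nontrivial nests is the convex hull of the points M(t,𝒩',ω) over maximal nestings 𝒩' ⊇ 𝒩. (b) The facet corresponding to a nesting with a unique nontrivial nest N is the image of the product P_{(t̄,ω̄)} × P_{(t̃,ω̃)} under the linear isomorphism permuting coordinates by the shuffle σ_N, where t̄ is t with the nest N contracted and ω̄ assigns to the contracted vertex the sum of the weights of the vertices of t(N) (other vertices keeping their weights), and t̃ = t(N) with weight ω̃ the restriction of ω; hence every face of a Loday realization is isomorphic, via a permutation of coordinates, to a product of Loday realizations of lower dimension. -/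

import Mathlib

open scoped BigOperators

noncomputable section

/-- Vectors in `ℝⁿ`. -/
abbrev Vec (n : ℕ) := Fin n → ℝ

/-- The standard scalar product on `ℝⁿ`. -/
def dot {n : ℕ} (x y : Vec n) : ℝ := ∑ i, x i * y i

/-- A polytope is the convex hull of a finite set of points. -/
def IsPolytope {n : ℕ} (P : Set (Vec n)) : Prop :=
  ∃ S : Finset (Vec n), P = convexHull ℝ (S : Set (Vec n))

/-- A face of `P`: either `P` itself (take `c = 0`) or the subset of `P` where some linear
functional attains its maximum over `P`. -/
def IsFace {n : ℕ} (P F : Set (Vec n)) : Prop :=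
  ∃ c : Vec n, F = {x ∈ P | ∀ y ∈ P, dot c y ≤ dot c x}

/-- Dimension of a subset of `ℝⁿ`: the rank of the direction of its affine span. -/
noncomputable def sdim {n : ℕ} (A : Set (Vec n)) : ℕ :=
  Module.finrank ℝ (affineSpan ℝ A).direction

/-- The normal cone of a face `F` of `P`. -/
def normalCone {n : ℕ} (P F : Set (Vec n)) : Set (Vec n) :=
  {c | F ⊆ {x ∈ P | ∀ y ∈ P, dot c y ≤ dot c x}}

/-- `coneOf X`: nonnegative linear combinations of finitely many elements of `X`. -/
def coneOf {n : ℕ} (X : Set (Vec n)) : Set (Vec n) :=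
  {v | ∃ (k : ℕ) (x : Fin k → Vec n) (l : Fin k → ℝ),
      (∀ i, x i ∈ X) ∧ (∀ i, 0 ≤ l i) ∧ v = ∑ i, l i • x i}

/-- The reflection `ρ_z P = 2z - P` of `P` with respect to `z`. -/
def reflP {n : ℕ} (z : Vec n) (P : Set (Vec n)) : Set (Vec n) :=
  (fun x => (2 : ℝ) • z - x) '' P

/-- An edge is a 1-dimensional face. -/
def IsEdge {n : ℕ} (P E : Set (Vec n)) : Prop := IsFace P E ∧ sdim E = 1

/-- `(P, v)` is oriented if `v` is not perpendicular to any edge of `P`. -/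
def Oriented {n : ℕ} (P : Set (Vec n)) (v : Vec n) : Prop :=
  ∀ E, IsEdge P E → ∀ d ∈ (affineSpan ℝ E).direction, d ≠ 0 → dot d v ≠ 0

/-- `(P, v)` is positively oriented if `(P ∩ ρ_z P, v)` is oriented for every `z ∈ P`. -/
def PosOriented {n : ℕ} (P : Set (Vec n)) (v : Vec n) : Prop :=
  ∀ z ∈ P, Oriented (P ∩ reflP z P) v

/-- `x` is the minimizer of `⟨-, v⟩` on `P`. -/
def IsBotOf {n : ℕ} (P : Set (Vec n)) (v x : Vec n) : Prop :=
  x ∈ P ∧ ∀ y ∈ P, dot v x ≤ dot v y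

/-- `x` is the maximizer of `⟨-, v⟩` on `P`. -/
def IsTopOf {n : ℕ} (P : Set (Vec n)) (v x : Vec n) : Prop :=
  x ∈ P ∧ ∀ y ∈ P, dot v y ≤ dot v x

/-- `(P, v)` is quasi-oriented if `⟨-, v⟩` has a unique minimizer and a unique maximizer on `P`. -/
def QuasiOriented {n : ℕ} (P : Set (Vec n)) (v : Vec n) : Prop :=
  (∃! x, IsBotOf P v x) ∧ (∃! x, IsTopOf P v x)

/-- `(P, v)` is quasi-positively oriented if `(P ∩ ρ_z P, v)` is quasi-oriented for all `z ∈ P`. -/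
def QuasiPosOriented {n : ℕ} (P : Set (Vec n)) (v : Vec n) : Prop :=
  ∀ z ∈ P, QuasiOriented (P ∩ reflP z P) v

/-- The polytope `P^φ = π^φ(P × P) ⊆ ℝ^{n+1}`, where `π^φ(x,y) = ((x+y)/2, ⟨x - y, v⟩)`. -/
def Pphi {n : ℕ} (P : Set (Vec n)) (v : Vec n) : Set (Vec (n + 1)) :=
  {w | ∃ x ∈ P, ∃ y ∈ P, w = Fin.snoc ((1 / 2 : ℝ) • (x + y)) (dot (x - y) v)}

/-- The pair of faces `(F, G)` belongs to `F^φ`: there are no `x ∈ F`, `y ∈ G`, `λ > 0` with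
`(π(x,y), φ(x,y) - λ) ∈ P^φ`. -/
def InFphi {n : ℕ} (P : Set (Vec n)) (v : Vec n) (F G : Set (Vec n)) : Prop :=
  ¬ ∃ x ∈ F, ∃ y ∈ G, ∃ lam : ℝ, 0 < lam ∧
      (Fin.snoc ((1 / 2 : ℝ) • (x + y)) (dot (x - y) v - lam) : Vec (n + 1)) ∈ Pphi P v

/-- The set `(A + B)/2`. -/
def avgSet {n : ℕ} (A B : Set (Vec n)) : Set (Vec n) :=
  {z | ∃ x ∈ A, ∃ y ∈ B, z = (1 / 2 : ℝ) • (x + y)}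

/-- The coherent subdivision `π(F^φ)` is tight. -/
def TightSub {n : ℕ} (P : Set (Vec n)) (v : Vec n) : Prop :=
  ∀ F G : Set (Vec n), IsFace P F → IsFace P G → F.Nonempty → G.Nonempty →
    InFphi P v F G → sdim F + sdim G = sdim (avgSet F G)

/-- `d` is a direction of an edge of `P ∩ ρ_z P` for some `z ∈ P`; the hyperplanes of the
fundamental hyperplane arrangement `H_P` are the orthogonal complements of such directions. -/
def EdgeDir {n : ℕ} (P : Set (Vec n)) (d : Vec n) : Prop :=
  d ≠ 0 ∧ ∃ z ∈ P, ∃ E, IsEdge (P ∩ reflP z P) E ∧ d ∈ (affineSpan ℝ E).direction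

/-- The cone `cone(-N_P(F) ∪ N_P(G))`. -/
def diagCone {n : ℕ} (P F G : Set (Vec n)) : Set (Vec n) :=
  coneOf ((Neg.neg '' normalCone P F) ∪ normalCone P G)


/-- A planar rooted tree with `n` internal vertices labelled `0, …, n-1` in the clockwise-from-root
(depth-first preorder) order; `parent v` is the parent of the vertex `v`, the root being vertex `0`.
The internal edge `e : Fin (n-1)` connects the vertex `e+1` to its parent. -/
structure PTree (n : ℕ) where
  parent : Fin n → Fin n
  parent_zero : ∀ v : Fin n, v.val = 0 → parent v = v
  parent_lt : ∀ v : Fin n, 0 < v.val → (parent v).val < v.val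
  preorder : ∀ v w : Fin n, w.val = v.val + 1 → ∃ k : ℕ, parent^[k] v = parent w

/-- The child endpoint of the edge `e`: the vertex labelled `e + 1`. -/
def childV {n : ℕ} (e : Fin (n - 1)) : Fin n :=
  ⟨e.val + 1, by have h := e.isLt; omega⟩

/-- The vertices of the closure of a set of edges `N`, i.e. `V(t(N))`. -/
def nestVtx {n : ℕ} (t : PTree n) (N : Finset (Fin (n - 1))) : Finset (Fin n) :=
  N.biUnion fun e => {childV e, t.parent (childV e)}

/-- Two distinct edges are adjacent when they share a vertex. -/
def edgeAdj {n : ℕ} (t : PTree n) (e f : Fin (n - 1)) : Prop :=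
  e ≠ f ∧ (({childV e, t.parent (childV e)} ∩ {childV f, t.parent (childV f)} :
      Finset (Fin n))).Nonempty

instance {n : ℕ} (t : PTree n) (e f : Fin (n - 1)) : Decidable (edgeAdj t e f) := by
  unfold edgeAdj; infer_instance

/-- A nest: a set of edges whose closure is a connected subgraph (the trivial nest `E(t)` is
also allowed when `n = 1`, where it is empty). -/
def IsNest {n : ℕ} (t : PTree n) (N : Finset (Fin (n - 1))) : Prop :=
  (N.Nonempty ∨ N = Finset.univ) ∧
    ∀ e ∈ N, ∀ f ∈ N,
      Relation.ReflTransGen (fun a b => a ∈ N ∧ b ∈ N ∧ edgeAdj t a b) e f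

/-- A nesting: a set of nests containing the trivial nest, any two of which are nested or
disjoint, disjoint ones having no adjacent edges. -/
def IsNesting {n : ℕ} (t : PTree n) (𝒩 : Finset (Finset (Fin (n - 1)))) : Prop :=
  (∀ N ∈ 𝒩, IsNest t N) ∧ Finset.univ ∈ 𝒩 ∧
    ∀ N ∈ 𝒩, ∀ M ∈ 𝒩,
      N ⊆ M ∨ M ⊆ N ∨ (Disjoint N M ∧ ∀ e ∈ N, ∀ f ∈ M, ¬ edgeAdj t e f)

/-- A maximal nesting: a nesting of (maximal) cardinality `n - 1`. -/
def IsMaxNesting {n : ℕ} (t : PTree n) (𝒩 : Finset (Finset (Fin (n - 1)))) : Prop :=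
  IsNesting t 𝒩 ∧ 𝒩.card = n - 1

/-- `min 𝒩(i)`: the smallest nest of `𝒩` containing the edge `i` (the nests of a nesting
containing `i` being totally ordered, this is their intersection). -/
def minNest {n : ℕ} (𝒩 : Finset (Finset (Fin (n - 1)))) (i : Fin (n - 1)) :
    Finset (Fin (n - 1)) :=
  (𝒩.filter fun N => i ∈ N).inf id

/-- `u` is a weak ancestor of `w` (any ancestor is reached in at most `n` steps). -/
def isAnc {n : ℕ} (t : PTree n) (u w : Fin n) : Prop :=
  ∃ k ∈ Finset.range (n + 1), t.parent^[k] w = u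

instance {n : ℕ} (t : PTree n) (u w : Fin n) : Decidable (isAnc t u w) := by
  unfold isAnc; infer_instance

/-- `α_i`: the total weight of the subtree `t₁` of `t(min𝒩(i))` having the edge `i` as root. -/
def alphaN {n : ℕ} (t : PTree n) (𝒩 : Finset (Finset (Fin (n - 1))))
    (ω : Fin n → ℤ) (i : Fin (n - 1)) : ℤ :=
  ∑ w ∈ (nestVtx t (minNest 𝒩 i)).filter (fun w => isAnc t (childV i) w), ω w

/-- `β_i`: the total weight of the subtree `t₂` of `t(min𝒩(i))` having the edge `i` as a leaf. -/
def betaN {n : ℕ} (t : PTree n) (𝒩 : Finset (Finset (Fin (n - 1))))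
    (ω : Fin n → ℤ) (i : Fin (n - 1)) : ℤ :=
  ∑ w ∈ (nestVtx t (minNest 𝒩 i)).filter (fun w => ¬ isAnc t (childV i) w), ω w

/-- The point `M(t, 𝒩, ω) = (α₁β₁, …, α_{n-1}β_{n-1})`. -/
noncomputable def MPoint {n : ℕ} (t : PTree n) (𝒩 : Finset (Finset (Fin (n - 1))))
    (ω : Fin n → ℤ) : Vec (n - 1) :=
  fun i => ((alphaN t 𝒩 ω i : ℤ) : ℝ) * ((betaN t 𝒩 ω i : ℤ) : ℝ)

/-- The Loday realization `P_{(t,ω)}` of the operahedron. -/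
noncomputable def Loday {n : ℕ} (t : PTree n) (ω : Fin n → ℤ) : Set (Vec (n - 1)) :=
  convexHull ℝ {x | ∃ 𝒩, IsMaxNesting t 𝒩 ∧ x = MPoint t 𝒩 ω}

/-- The face of `P_{(t,ω)}` associated to a nesting `𝒩`: the convex hull of the points
`M(t,𝒩',ω)` over the maximal nestings `𝒩' ⊇ 𝒩`. -/
noncomputable def faceOfNesting {n : ℕ} (t : PTree n) (ω : Fin n → ℤ)
    (𝒩 : Finset (Finset (Fin (n - 1)))) : Set (Vec (n - 1)) :=
  convexHull ℝ {x | ∃ 𝒩', IsMaxNesting t 𝒩' ∧ 𝒩 ⊆ 𝒩' ∧ x = MPoint t 𝒩' ω}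

/-- A pair `(I, J) ∈ D(m)`: disjoint subsets of the same cardinality with `min (I ∪ J) ∈ I`. -/
def DPair {m : ℕ} (I J : Finset (Fin m)) : Prop :=
  I.card = J.card ∧ Disjoint I J ∧ ∃ i ∈ I, ∀ x ∈ I ∪ J, i ≤ x

/-- A trinary vector: all coordinates are `0`, `1` or `-1`. -/
def Trinary {m : ℕ} (u : Vec m) : Prop := ∀ i, u i = 0 ∨ u i = 1 ∨ u i = -1

/-- A balanced vector: same number of coordinates equal to `1` and to `-1`. -/
def BalancedVec {m : ℕ} (u : Vec m) : Prop :=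
  (Finset.univ.filter fun i => u i = 1).card = (Finset.univ.filter fun i => u i = -1).card

/-- The first nonzero coordinate is `1`. -/
def FirstPos {m : ℕ} (u : Vec m) : Prop :=
  ∀ i, u i ≠ 0 → (∀ j, j < i → u j = 0) → u i = 1
/-- The facet of `P_{(t,ω)}` corresponding to the nesting `{E(t), N}` with unique nontrivial
nest `N` is the image, under the permutation-of-coordinates map `Θ` induced by the shuffle
`σ_N`, of the product `P_{(t̄,ω̄)} × P_{(t̃,ω̃)}`, where `t̃ = t(N)` carries the restricted
weight and `t̄` is `t` with the nest `N` contracted onto its root vertex `r`, which carries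
the total weight of `V(t(N))`.  The trees `t̄`, `t̃` are described through the order-preserving
relabelings `f`, `e` of their vertex sets, and `σ_N` through its values on edge labels. -/
def FacetProduct {n : ℕ} (t : PTree n) (ω : Fin n → ℤ) (N : Finset (Fin (n - 1))) : Prop :=
  ∃ (k : ℕ) (r : Fin n), (nestVtx t N).card = k ∧ r ∈ nestVtx t N ∧
    (∀ u ∈ nestVtx t N, r ≤ u) ∧
  ∃ (tsub : PTree k) (tcon : PTree (n - k + 1))
    (e : Fin k ≃o {u : Fin n // u ∈ nestVtx t N})
    (f : Fin (n - k + 1) ≃o {u : Fin n // u ∈ insert r (Finset.univ \ nestVtx t N)})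
    (σ : (Fin (n - k) ⊕ Fin (k - 1)) ≃ Fin (n - 1)),
    (∀ b : Fin k, 0 < b.val → (e (tsub.parent b)).1 = t.parent (e b).1) ∧
    (∀ a : Fin (n - k + 1), 0 < a.val →
      (f (tcon.parent a)).1 =
        if t.parent (f a).1 ∈ nestVtx t N then r else t.parent (f a).1) ∧
    (∀ b : Fin (k - 1),
      (σ (Sum.inr b)).val + 1 = (e ⟨b.val + 1, by have h := b.isLt; omega⟩).1.val) ∧
    (∀ a : Fin (n - k),
      (σ (Sum.inl a)).val + 1 = (f ⟨a.val + 1, by have h := a.isLt; omega⟩).1.val) ∧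
    faceOfNesting t ω ({Finset.univ, N} : Finset (Finset (Fin (n - 1)))) =
      {w : Vec (n - 1) | ∃ (x : Vec (n - k)) (y : Vec (k - 1)),
        x ∈ Loday tcon
          (fun a => if (f a).1 = r then ∑ u ∈ nestVtx t N, ω u else ω (f a).1) ∧
        y ∈ Loday tsub (fun b => ω (e b).1) ∧
        w = fun j => Sum.elim x y (σ.symm j)}

/-- A face of a Loday realization is isomorphic, via a permutation of coordinates, to a product
of Loday realizations of operahedra of lower dimension. -/
def ProductDecomp {n : ℕ} (t : PTree n) (ω : Fin n → ℤ)
    (𝒩 : Finset (Finset (Fin (n - 1)))) : Prop :=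
  ∃ (m : ℕ) (dims : Fin m → ℕ) (trees : ∀ j, PTree (dims j))
    (ωs : ∀ j, Fin (dims j) → ℤ)
    (σ : (Σ j : Fin m, Fin (dims j - 1)) ≃ Fin (n - 1)),
    (∀ j, dims j < n) ∧ (∀ j i, 0 < ωs j i) ∧
    faceOfNesting t ω 𝒩 =
      {w : Vec (n - 1) | ∃ x : ∀ j, Vec (dims j - 1),
        (∀ j, x j ∈ Loday (trees j) (ωs j)) ∧
        w = fun i => x (σ.symm i).1 (σ.symm i).2}

section Ancestors

variable {n : ℕ} (t : PTree n)

theorem isAnc_iff_exists {u w : Fin n} : isAnc t u w ↔ ∃ k : ℕ, t.parent^[k] w = u := by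
  constructor
  · rintro ⟨k, -, h⟩
    exact ⟨k, h⟩
  · rintro ⟨k, h⟩
    have key : ∀ (m : ℕ) (w : Fin n), w.val ≤ m → ∀ k, ∃ l ≤ m, t.parent^[l] w = t.parent^[k] w := by
      intro m
      induction m with
      | zero =>
        intro w hw k
        refine ⟨0, le_rfl, ?_⟩
        have hp := t.parent_zero w (by omega)
        rw [Function.iterate_fixed hp, Function.iterate_fixed hp]
      | succ m ih =>
        intro w hw k
        by_cases h0 : w.val = 0
        · obtain ⟨l, hl, h⟩ := ih w (by omega) k
          exact ⟨l, by omega, h⟩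
        · cases k with
          | zero => exact ⟨0, by omega, rfl⟩
          | succ k =>
            have hlt := t.parent_lt w (by omega)
            obtain ⟨l, hl, h⟩ := ih (t.parent w) (by omega) k
            exact ⟨l + 1, by omega, by simpa [Function.iterate_succ_apply] using h⟩
    obtain ⟨l, hl, h'⟩ := key w.val w le_rfl k
    exact ⟨l, by simp; omega, h'.trans h⟩

theorem isAnc_refl (u : Fin n) : isAnc t u u := (isAnc_iff_exists t).2 ⟨0, rfl⟩

theorem isAnc_step {u w : Fin n} :
    isAnc t u w ↔ u = w ∨ (0 < w.val ∧ isAnc t u (t.parent w)) := by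
  simp only [isAnc_iff_exists]
  constructor
  · rintro ⟨k, h⟩
    by_cases h0 : w.val = 0
    · rw [Function.iterate_fixed (t.parent_zero w h0)] at h
      exact Or.inl h.symm
    · cases k with
      | zero => exact Or.inl h.symm
      | succ k => exact Or.inr ⟨by omega, k, h⟩
  · rintro (rfl | ⟨-, k, h⟩)
    · exact ⟨0, rfl⟩
    · exact ⟨k + 1, h⟩

theorem isAnc_parent (w : Fin n) : isAnc t (t.parent w) w := (isAnc_iff_exists t).2 ⟨1, rfl⟩

variable {t}

theorem isAnc.trans {u v w : Fin n} (h : isAnc t u v) (h' : isAnc t v w) : isAnc t u w := by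
  rw [isAnc_iff_exists] at *
  obtain ⟨k, rfl⟩ := h
  obtain ⟨l, rfl⟩ := h'
  exact ⟨k + l, Function.iterate_add_apply _ _ _ _⟩

theorem isAnc.le {u w : Fin n} (h : isAnc t u w) : u.val ≤ w.val := by
  induction hm : w.val using Nat.strong_induction_on generalizing w with
  | _ m ih =>
    rcases (isAnc_step t).1 h with rfl | ⟨h0, h⟩
    · exact hm.le
    · have hlt := t.parent_lt w h0
      have := ih _ (by omega) h rfl
      omega

theorem isAnc_of_val_eq_zero {u : Fin n} (hu : u.val = 0) (w : Fin n) : isAnc t u w := by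
  induction hm : w.val using Nat.strong_induction_on generalizing w with
  | _ m ih =>
    by_cases h0 : w.val = 0
    · have : u = w := Fin.ext (by omega)
      exact this ▸ isAnc_refl t u
    · have hlt := t.parent_lt w (by omega)
      exact (isAnc_step t).2 (Or.inr ⟨by omega, ih _ (by omega) _ rfl⟩)

/-- The descendants of a vertex form an interval of labels. -/
theorem isAnc.of_le {u v w : Fin n} (h : isAnc t u w) (huv : u ≤ v) (hvw : v ≤ w) :
    isAnc t u v := by
  induction hm : w.val using Nat.strong_induction_on generalizing w with
  | _ m ih =>
    rw [Fin.le_def] at huv hvw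
    by_cases hw : v = w
    · exact hw ▸ h
    have hne : v.val ≠ w.val := fun h => hw (Fin.ext h)
    rcases (isAnc_step t).1 h with rfl | ⟨h0, h⟩
    · omega
    · have hw' : w.val - 1 < n := by omega
      obtain ⟨k, hk⟩ := t.preorder ⟨w.val - 1, hw'⟩ w (by simp; omega)
      have h1 : isAnc t u ⟨w.val - 1, hw'⟩ := h.trans ((isAnc_iff_exists t).2 ⟨k, hk⟩)
      exact ih (w.val - 1) (by omega) h1 (by rw [Fin.le_def]; simp; omega) rfl

end Ancestors

section Edges

variable {n : ℕ} {t : PTree n}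

theorem childV_pos (e : Fin (n - 1)) : 0 < (childV e).val := Nat.succ_pos _

theorem childV_injective : Function.Injective (childV (n := n)) := by
  intro e f h
  simpa [childV, Fin.ext_iff] using h

/-- The edge connecting a non-root vertex to its parent. -/
def edgeOf (v : Fin n) (h : 0 < v.val) : Fin (n - 1) := ⟨v.val - 1, by have := v.isLt; omega⟩

@[simp] theorem childV_edgeOf (v : Fin n) (h : 0 < v.val) : childV (edgeOf v h) = v := by
  ext; simp [childV, edgeOf]; omega

theorem parent_childV_lt (t : PTree n) (e : Fin (n - 1)) :
    (t.parent (childV e)).val < (childV e).val := t.parent_lt _ (childV_pos e)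

theorem not_isAnc_childV_parent (t : PTree n) (e : Fin (n - 1)) :
    ¬ isAnc t (childV e) (t.parent (childV e)) := fun h => by
  have h1 := h.le
  have h2 := parent_childV_lt t e
  omega

theorem isAnc_childV_iff {e f : Fin (n - 1)} (h : e ≠ f) :
    isAnc t (childV e) (childV f) ↔ isAnc t (childV e) (t.parent (childV f)) := by
  rw [isAnc_step]
  simp [childV_pos, childV_injective.eq_iff, h]

theorem mem_nestVtx {N : Finset (Fin (n - 1))} {v : Fin n} :
    v ∈ nestVtx t N ↔ ∃ e ∈ N, v = childV e ∨ v = t.parent (childV e) := by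
  simp [nestVtx]

theorem childV_mem_nestVtx {N : Finset (Fin (n - 1))} {e : Fin (n - 1)} (h : e ∈ N) :
    childV e ∈ nestVtx t N := mem_nestVtx.2 ⟨e, h, Or.inl rfl⟩

theorem parent_mem_nestVtx {N : Finset (Fin (n - 1))} {e : Fin (n - 1)} (h : e ∈ N) :
    t.parent (childV e) ∈ nestVtx t N := mem_nestVtx.2 ⟨e, h, Or.inr rfl⟩

theorem edgeAdj_iff {e f : Fin (n - 1)} : edgeAdj t e f ↔ e ≠ f ∧
    ∃ x, (x = childV e ∨ x = t.parent (childV e)) ∧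
      (x = childV f ∨ x = t.parent (childV f)) := by
  simp [edgeAdj, Finset.Nonempty, Finset.mem_inter]

theorem edgeAdj.symm {e f : Fin (n - 1)} (h : edgeAdj t e f) : edgeAdj t f e := by
  rw [edgeAdj_iff] at *
  obtain ⟨h, x, h1, h2⟩ := h
  exact ⟨h.symm, x, h2, h1⟩

variable (t) in
/-- A set of edges any two of which are linked by a chain of adjacent edges of the set. -/
def EdgeConnected (N : Finset (Fin (n - 1))) : Prop :=
  ∀ e ∈ N, ∀ f ∈ N, Relation.ReflTransGen (fun a b => a ∈ N ∧ b ∈ N ∧ edgeAdj t a b) e f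

theorem EdgeConnected.exists_crossing {N M : Finset (Fin (n - 1))} (hN : EdgeConnected t N)
    {i j : Fin (n - 1)} (hi : i ∈ N) (hiM : i ∈ M) (hj : j ∈ N) (hjM : j ∉ M) :
    ∃ e ∈ N, e ∉ M ∧ ∃ f ∈ N, f ∈ M ∧ edgeAdj t e f := by
  have h := hN i hi j hj
  by_contra! hc
  refine hjM ?_
  clear hj hjM
  induction h with
  | refl => exact hiM
  | tail _ h ih =>
    by_contra hm
    exact hc _ h.2.1 hm _ h.1 ih h.2.2.symm

theorem edgeConnected_insert {N : Finset (Fin (n - 1))} (hN : EdgeConnected t N)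
    {e f : Fin (n - 1)} (hf : f ∈ N) (h : edgeAdj t e f) : EdgeConnected t (insert e N) := by
  have mono : ∀ a ∈ N, ∀ b ∈ N, Relation.ReflTransGen
      (fun a b => a ∈ insert e N ∧ b ∈ insert e N ∧ edgeAdj t a b) a b := fun a ha b hb =>
    Relation.ReflTransGen.mono (fun x y hxy =>
      ⟨Finset.mem_insert_of_mem hxy.1, Finset.mem_insert_of_mem hxy.2.1, hxy.2.2⟩) _ _
      (hN a ha b hb)
  have he : ∀ b ∈ N, Relation.ReflTransGen
      (fun a b => a ∈ insert e N ∧ b ∈ insert e N ∧ edgeAdj t a b) e b := fun b hb =>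
    (mono f hf b hb).head ⟨Finset.mem_insert_self _ _, Finset.mem_insert_of_mem hf, h⟩
  have he' : ∀ b ∈ N, Relation.ReflTransGen
      (fun a b => a ∈ insert e N ∧ b ∈ insert e N ∧ edgeAdj t a b) b e := fun b hb =>
    (mono b hb f hf).tail ⟨Finset.mem_insert_of_mem hf, Finset.mem_insert_self _ _, h.symm⟩
  intro a ha b hb
  rcases Finset.mem_insert.1 ha with rfl | ha' <;> rcases Finset.mem_insert.1 hb with rfl | hb'
  · exact .refl
  · exact he b hb'
  · exact he' a ha'
  · exact mono a ha' b hb'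

variable (t) in
/-- The set of edges separating two vertices, i.e. the edges of the path joining them. -/
def pathEdges (u v : Fin n) : Finset (Fin (n - 1)) :=
  Finset.univ.filter fun i => ¬ (isAnc t (childV i) u ↔ isAnc t (childV i) v)

theorem mem_pathEdges {u v : Fin n} {i : Fin (n - 1)} :
    i ∈ pathEdges t u v ↔ ¬ (isAnc t (childV i) u ↔ isAnc t (childV i) v) := by
  simp [pathEdges]

theorem pathEdges_comm (u v : Fin n) : pathEdges t u v = pathEdges t v u := by
  ext i; simp only [mem_pathEdges]; tauto

theorem pathEdges_self (u : Fin n) : pathEdges t u u = ∅ := by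
  ext i; simp [mem_pathEdges]

theorem mem_pathEdges_parent {i j : Fin (n - 1)} :
    i ∈ pathEdges t (childV j) (t.parent (childV j)) ↔ i = j := by
  rw [mem_pathEdges]
  by_cases h : i = j
  · subst h
    simp [isAnc_refl, not_isAnc_childV_parent]
  · simp [h, isAnc_childV_iff h]

theorem pathEdges_subset {N : Finset (Fin (n - 1))} (hN : EdgeConnected t N) {u v : Fin n}
    (hu : u ∈ nestVtx t N) (hv : v ∈ nestVtx t N) : pathEdges t u v ⊆ N := by
  intro i hi
  by_contra hiN
  rw [mem_pathEdges] at hi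
  have side : ∀ f ∈ N, ∀ x, (x = childV f ∨ x = t.parent (childV f)) →
      (isAnc t (childV i) x ↔ isAnc t (childV i) (childV f)) := by
    rintro f hf x (rfl | rfl)
    · rfl
    · exact (isAnc_childV_iff (by rintro rfl; exact hiN hf)).symm
  obtain ⟨e, he, hue⟩ := mem_nestVtx.1 hu
  obtain ⟨f, hf, hvf⟩ := mem_nestVtx.1 hv
  apply hi
  rw [side e he u hue, side f hf v hvf]
  have h := hN e he f hf
  clear hvf hf
  induction h with
  | refl => rfl
  | tail _ h ih =>
    obtain ⟨-, x, h1, h2⟩ := edgeAdj_iff.1 h.2.2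
    exact ih.trans ((side _ h.1 x h1).symm.trans (side _ h.2.1 x h2))

theorem exists_mem_pathEdges {u v : Fin n} (h : u ≠ v) :
    ∃ i ∈ pathEdges t u v, u = childV i ∨ u = t.parent (childV i) := by
  by_cases hA : isAnc t u v
  · induction hm : v.val using Nat.strong_induction_on generalizing v with
    | _ m ih =>
      rcases (isAnc_step t).1 hA with rfl | ⟨h0, hA'⟩
      · exact absurd rfl h
      have hlt := t.parent_lt v h0
      by_cases hp : u = t.parent v
      · refine ⟨edgeOf v h0, ?_, Or.inr (by simpa using hp)⟩
        have := (mem_pathEdges_parent (t := t) (i := edgeOf v h0)).2 rfl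
        rw [childV_edgeOf, ← hp, pathEdges_comm] at this
        exact this
      · obtain ⟨i, hi, hiu⟩ := ih _ (by omega) hp hA' rfl
        refine ⟨i, ?_, hiu⟩
        rw [mem_pathEdges] at hi ⊢
        have hne : childV i ≠ v := by
          rintro rfl
          have h1 := not_isAnc_childV_parent t i
          have h2 : ¬ isAnc t (childV i) u := fun h' => h1 (h'.trans hA')
          tauto
        rw [isAnc_step (w := v)]
        simpa [hne, h0] using hi
  · have h0 : 0 < u.val := by
      by_contra h0
      exact hA (isAnc_of_val_eq_zero (by omega) v)
    refine ⟨edgeOf u h0, ?_, Or.inl (by simp)⟩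
    rw [mem_pathEdges, childV_edgeOf]
    simp [isAnc_refl, hA]

theorem pathEdges_nonempty {u v : Fin n} (h : u ≠ v) : (pathEdges t u v).Nonempty :=
  let ⟨i, hi, _⟩ := exists_mem_pathEdges (t := t) h
  ⟨i, hi⟩

theorem mem_nestVtx_of_pathEdges_subset {N : Finset (Fin (n - 1))} {u v : Fin n} (h : u ≠ v)
    (hN : pathEdges t u v ⊆ N) : u ∈ nestVtx t N ∧ v ∈ nestVtx t N := by
  obtain ⟨i, hi, hu⟩ := exists_mem_pathEdges (t := t) h
  obtain ⟨j, hj, hv⟩ := exists_mem_pathEdges (t := t) h.symm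
  rw [pathEdges_comm] at hj
  exact ⟨mem_nestVtx.2 ⟨i, hN hi, hu⟩, mem_nestVtx.2 ⟨j, hN hj, hv⟩⟩

theorem pathEdges_eq_insert {u v : Fin n} (h0 : 0 < v.val) (hA : ¬ isAnc t v u) :
    pathEdges t u v = insert (edgeOf v h0) (pathEdges t u (t.parent v)) := by
  ext i
  rw [Finset.mem_insert, mem_pathEdges, mem_pathEdges]
  by_cases h : i = edgeOf v h0
  · subst h
    simp [hA, isAnc_refl]
  · have hv : childV i ≠ v := fun h' => h (childV_injective (by simpa using h'))
    rw [isAnc_step (w := v)]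
    simp [h, hv, h0]

theorem edgeConnected_pathEdges (u v : Fin n) : EdgeConnected t (pathEdges t u v) := by
  induction hm : u.val + v.val using Nat.strong_induction_on generalizing u v with
  | _ m ih =>
    wlog huv : u ≤ v generalizing u v
    · rw [pathEdges_comm]
      exact this v u (by omega) (le_of_not_ge huv)
    rw [Fin.le_def] at huv
    by_cases h : u = v
    · subst h
      rw [pathEdges_self]
      intro e he
      simp at he
    have hne : u.val ≠ v.val := fun h' => h (Fin.ext h')
    have h0 : 0 < v.val := by omega
    have hlt := t.parent_lt v h0
    rw [pathEdges_eq_insert h0 fun hA => by have := hA.le; omega]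
    by_cases hp : t.parent v = u
    · rw [hp, pathEdges_self]
      intro e he f hf
      simp only [insert_empty_eq, Finset.mem_singleton] at he hf
      rw [he, hf]
    · obtain ⟨i, hi, hi'⟩ := exists_mem_pathEdges (t := t) hp
      rw [pathEdges_comm] at hi
      refine edgeConnected_insert (ih _ (by omega) u (t.parent v) rfl) hi ?_
      rw [edgeAdj_iff]
      refine ⟨?_, t.parent v, Or.inr (by simp), hi'⟩
      rintro rfl
      rw [mem_pathEdges, childV_edgeOf] at hi
      have h1 : ¬ isAnc t v u := fun hA => by have := hA.le; omega
      have h2 : ¬ isAnc t v (t.parent v) := fun hA => by have := hA.le; omega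
      tauto

theorem exists_pathEdges_mem_mem {M : Finset (Fin (n - 1))} {i j : Fin (n - 1)} (hi : i ∈ M)
    (hj : j ∈ M) : ∃ u ∈ nestVtx t M, ∃ v ∈ nestVtx t M, i ∈ pathEdges t u v ∧
      j ∈ pathEdges t u v := by
  have key : ∀ i ∈ M, ∀ j ∈ M, i ≠ j → isAnc t (childV i) (childV j) →
      i ∈ pathEdges t (childV j) (t.parent (childV i)) ∧
      j ∈ pathEdges t (childV j) (t.parent (childV i)) := by
    intro i _ j _ hij h
    have h1 := not_isAnc_childV_parent t i
    have h2 : ¬ isAnc t (childV j) (t.parent (childV i)) := fun h' => h1 (h.trans h')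
    simp [mem_pathEdges, h, h1, h2, isAnc_refl]
  by_cases hij : i = j
  · subst hij
    exact ⟨_, childV_mem_nestVtx hi, _, parent_mem_nestVtx hi, mem_pathEdges_parent.2 rfl,
      mem_pathEdges_parent.2 rfl⟩
  by_cases h1 : isAnc t (childV i) (childV j)
  · exact ⟨_, childV_mem_nestVtx hj, _, parent_mem_nestVtx hi, key i hi j hj hij h1⟩
  by_cases h2 : isAnc t (childV j) (childV i)
  · exact ⟨_, childV_mem_nestVtx hi, _, parent_mem_nestVtx hj,
      (key j hj i hi (Ne.symm hij) h2).symm⟩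
  · exact ⟨_, childV_mem_nestVtx hi, _, childV_mem_nestVtx hj, by
      simp [mem_pathEdges, h1, h2, isAnc_refl]⟩

theorem edgeConnected_univ (t : PTree n) : EdgeConnected t Finset.univ := by
  intro e he f hf
  obtain ⟨u, -, v, -, h1, h2⟩ := exists_pathEdges_mem_mem (t := t) he hf
  exact Relation.ReflTransGen.mono (fun x y hxy =>
    ⟨Finset.mem_univ _, Finset.mem_univ _, hxy.2.2⟩) _ _ (edgeConnected_pathEdges u v e h1 f h2)

end Edges

section Nestings

variable {n : ℕ} {t : PTree n}

theorem isNest_of_mem {N : Finset (Fin (n - 1))} {i : Fin (n - 1)} (hi : i ∈ N)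
    (hN : EdgeConnected t N) : IsNest t N := ⟨Or.inl ⟨i, hi⟩, hN⟩

theorem isNest_univ (t : PTree n) : IsNest t Finset.univ := ⟨Or.inr rfl, edgeConnected_univ t⟩

theorem IsNest.nonempty (hn : 2 ≤ n) {N : Finset (Fin (n - 1))} (hN : IsNest t N) :
    N.Nonempty := by
  rcases hN.1 with h | rfl
  · exact h
  · exact ⟨⟨0, by omega⟩, Finset.mem_univ _⟩

theorem IsNest.connected {N : Finset (Fin (n - 1))} (hN : IsNest t N) : EdgeConnected t N := hN.2

theorem mem_minNest {𝒩 : Finset (Finset (Fin (n - 1)))} {i j : Fin (n - 1)} :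
    j ∈ minNest 𝒩 i ↔ ∀ N ∈ 𝒩, i ∈ N → j ∈ N := by
  rw [minNest, ← Finset.singleton_subset_iff, Finset.le_inf_iff]
  simp

theorem self_mem_minNest (𝒩 : Finset (Finset (Fin (n - 1)))) (i : Fin (n - 1)) :
    i ∈ minNest 𝒩 i := mem_minNest.2 fun _ _ h => h

theorem minNest_subset {𝒩 : Finset (Finset (Fin (n - 1)))} {N : Finset (Fin (n - 1))}
    (hN : N ∈ 𝒩) {i : Fin (n - 1)} (hi : i ∈ N) : minNest 𝒩 i ⊆ N :=
  fun _ hj => mem_minNest.1 hj N hN hi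

theorem minNest_anti {𝒩 𝒩' : Finset (Finset (Fin (n - 1)))} (h : 𝒩 ⊆ 𝒩') (i : Fin (n - 1)) :
    minNest 𝒩' i ⊆ minNest 𝒩 i :=
  fun _ hj => mem_minNest.2 fun N hN hi => mem_minNest.1 hj N (h hN) hi

theorem IsNesting.minNest_mem {𝒩 : Finset (Finset (Fin (n - 1)))} (h : IsNesting t 𝒩)
    (i : Fin (n - 1)) : minNest 𝒩 i ∈ 𝒩 := by
  obtain ⟨N, hN, hmin⟩ := Finset.exists_min_image (𝒩.filter fun N => i ∈ N) Finset.card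
    ⟨Finset.univ, by simp [h.2.1]⟩
  simp only [Finset.mem_filter] at hN hmin
  have : minNest 𝒩 i = N := by
    refine (minNest_subset hN.1 hN.2).antisymm fun j hj => mem_minNest.2 fun M hM hi => ?_
    rcases h.2.2 N hN.1 M hM with h1 | h1 | h1
    · exact h1 hj
    · rwa [Finset.eq_of_subset_of_card_le h1 (hmin M ⟨hM, hi⟩)]
    · exact absurd hi (Finset.disjoint_left.1 h1.1 hN.2)
  rw [this]
  exact hN.1

theorem minNest_eq_of_mem {𝒩 : Finset (Finset (Fin (n - 1)))} (h : IsNesting t 𝒩)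
    {i j : Fin (n - 1)} (hij : i ∈ minNest 𝒩 j) (hji : j ∈ minNest 𝒩 i) :
    minNest 𝒩 i = minNest 𝒩 j :=
  (minNest_subset (h.minNest_mem j) hij).antisymm (minNest_subset (h.minNest_mem i) hji)

/-- Every connected set of edges contains an edge whose smallest nest contains the whole set. -/
theorem IsNesting.exists_subset_minNest {𝒩 : Finset (Finset (Fin (n - 1)))}
    (h : IsNesting t 𝒩) {S : Finset (Fin (n - 1))} (hS : EdgeConnected t S) (hne : S.Nonempty) :
    ∃ i ∈ S, S ⊆ minNest 𝒩 i := by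
  obtain ⟨i, hi, hmax⟩ := Finset.exists_max_image S (fun i => (minNest 𝒩 i).card) hne
  refine ⟨i, hi, fun j hj => ?_⟩
  by_contra hjM
  obtain ⟨e, he, heM, f, hf, hfM, hadj⟩ :=
    hS.exists_crossing hi (self_mem_minNest 𝒩 i) hj hjM
  rcases h.2.2 _ (h.minNest_mem e) _ (h.minNest_mem i) with h1 | h1 | h1
  · exact heM (h1 (self_mem_minNest 𝒩 e))
  · have := Finset.eq_of_subset_of_card_le h1 (hmax e he)
    exact heM (this ▸ self_mem_minNest 𝒩 e)
  · exact h1.2 e (self_mem_minNest 𝒩 e) f hfM hadj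

theorem IsNesting.exists_eq_minNest (hn : 2 ≤ n) {𝒩 : Finset (Finset (Fin (n - 1)))}
    (h : IsNesting t 𝒩) {N : Finset (Fin (n - 1))} (hN : N ∈ 𝒩) :
    ∃ i ∈ N, minNest 𝒩 i = N := by
  obtain ⟨i, hi, hNi⟩ := h.exists_subset_minNest (h.1 N hN).2 ((h.1 N hN).nonempty hn)
  exact ⟨i, hi, (minNest_subset hN hi).antisymm hNi⟩

theorem IsNesting.image_minNest (hn : 2 ≤ n) {𝒩 : Finset (Finset (Fin (n - 1)))}
    (h : IsNesting t 𝒩) : Finset.univ.image (minNest 𝒩) = 𝒩 := by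
  ext N
  simp only [Finset.mem_image, Finset.mem_univ, true_and]
  constructor
  · rintro ⟨i, rfl⟩
    exact h.minNest_mem i
  · intro hN
    obtain ⟨i, -, hi⟩ := h.exists_eq_minNest hn hN
    exact ⟨i, hi⟩

theorem IsNesting.card_le (hn : 2 ≤ n) {𝒩 : Finset (Finset (Fin (n - 1)))}
    (h : IsNesting t 𝒩) : 𝒩.card ≤ n - 1 := by
  rw [← h.image_minNest hn]
  exact Finset.card_image_le.trans (by simp)

theorem isMaxNesting_iff (hn : 2 ≤ n) {𝒩 : Finset (Finset (Fin (n - 1)))} :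
    IsMaxNesting t 𝒩 ↔ IsNesting t 𝒩 ∧ Function.Injective (minNest 𝒩) := by
  refine and_congr_right fun h => ?_
  conv_lhs => rw [← h.image_minNest hn]
  rw [← Set.injOn_univ, ← Finset.coe_univ, ← Finset.card_image_iff]
  simp

theorem IsMaxNesting.eq_of_subset (hn : 2 ≤ n) {𝒦 𝒩 : Finset (Finset (Fin (n - 1)))}
    (hK : IsMaxNesting t 𝒦) (hN : IsNesting t 𝒩) (h : 𝒦 ⊆ 𝒩) : 𝒦 = 𝒩 :=
  Finset.eq_of_subset_of_card_le h (by rw [hK.2]; exact hN.card_le hn)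

section CutNests

variable {α : Type*} [LinearOrder α]

open Classical in
variable (t) in
/-- The nests that are connected components of a sublevel set of `c`. -/
def cutNests (c : Fin (n - 1) → α) : Finset (Finset (Fin (n - 1))) :=
  Finset.univ.filter fun N =>
    IsNest t N ∧ ∀ e ∉ N, ∀ f ∈ N, edgeAdj t e f → ∀ g ∈ N, c g < c e

theorem mem_cutNests {c : Fin (n - 1) → α} {N : Finset (Fin (n - 1))} :
    N ∈ cutNests t c ↔
      IsNest t N ∧ ∀ e ∉ N, ∀ f ∈ N, edgeAdj t e f → ∀ g ∈ N, c g < c e := by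
  simp [cutNests]

theorem isNesting_cutNests (hn : 2 ≤ n) (c : Fin (n - 1) → α) : IsNesting t (cutNests t c) := by
  refine ⟨fun N hN => (mem_cutNests.1 hN).1, mem_cutNests.2 ⟨isNest_univ t, by simp⟩, ?_⟩
  intro N hN M hM
  rw [mem_cutNests] at hN hM
  obtain ⟨a, ha, hamax⟩ := Finset.exists_max_image N c (hN.1.nonempty hn)
  obtain ⟨b, hb, hbmax⟩ := Finset.exists_max_image M c (hM.1.nonempty hn)
  have key : ∀ {N M : Finset (Fin (n - 1))} {a b : Fin (n - 1)}, IsNest t N →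
      (∀ e ∉ M, ∀ f ∈ M, edgeAdj t e f → ∀ g ∈ M, c g < c e) → (∀ e ∈ N, c e ≤ c a) → b ∈ M →
      c a ≤ c b → ¬ N ⊆ M → Disjoint N M ∧ ∀ e ∈ N, ∀ f ∈ M, ¬ edgeAdj t e f := by
    intro N M a b hN hM ha hb hab hNM
    have hdis : Disjoint N M := by
      rw [Finset.disjoint_left]
      intro i hiN hiM
      obtain ⟨j, hj, hjM⟩ := Finset.not_subset.1 hNM
      obtain ⟨e, he, heM, f, hf, hfM, hadj⟩ := hN.connected.exists_crossing hiN hiM hj hjM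
      exact absurd (hM e heM f hfM hadj b hb) (not_lt.2 ((ha e he).trans hab))
    refine ⟨hdis, fun e he f hf hadj => ?_⟩
    exact absurd (hM e (Finset.disjoint_left.1 hdis he) f hf hadj b hb)
      (not_lt.2 ((ha e he).trans hab))
  by_cases h1 : N ⊆ M
  · exact Or.inl h1
  by_cases h2 : M ⊆ N
  · exact Or.inr (Or.inl h2)
  right; right
  rcases le_total (c a) (c b) with hab | hab
  · exact key hN.1 hM.2 hamax hb hab h1
  · obtain ⟨h3, h4⟩ := key hM.1 hN.2 hbmax ha hab h2
    exact ⟨h3.symm, fun e he f hf hadj => h4 f hf e he hadj.symm⟩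

/-- The component containing `i` of the sublevel set at the level of `i`. -/
theorem le_of_mem_minNest_cutNests {c : Fin (n - 1) → α} {i j : Fin (n - 1)}
    (hj : j ∈ minNest (cutNests t c) i) : c j ≤ c i := by
  classical
  let r : Fin (n - 1) → Fin (n - 1) → Prop := fun a b => c a ≤ c i ∧ c b ≤ c i ∧ edgeAdj t a b
  let C : Finset (Fin (n - 1)) := Finset.univ.filter fun j => Relation.ReflTransGen r i j
  have hC : ∀ j, j ∈ C ↔ Relation.ReflTransGen r i j := by simp [C]
  have hi : i ∈ C := (hC i).2 .refl
  have hle : ∀ j ∈ C, c j ≤ c i := by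
    intro j hj
    rw [hC] at hj
    cases hj with
    | refl => exact le_rfl
    | tail _ h => exact h.2.1
  have hrs : ∀ a b, r a b → r b a := fun a b h => ⟨h.2.1, h.1, h.2.2.symm⟩
  have hfrom : ∀ j, Relation.ReflTransGen r i j →
      Relation.ReflTransGen (fun a b => a ∈ C ∧ b ∈ C ∧ edgeAdj t a b) i j ∧
      Relation.ReflTransGen (fun a b => a ∈ C ∧ b ∈ C ∧ edgeAdj t a b) j i := by
    intro j hj
    induction hj with
    | refl => exact ⟨.refl, .refl⟩
    | tail h h' ih =>
      have h1 := (hC _).2 h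
      have h2 := (hC _).2 (h.tail h')
      exact ⟨ih.1.tail ⟨h1, h2, h'.2.2⟩, ih.2.head ⟨h2, h1, h'.2.2.symm⟩⟩
  have hmem : C ∈ cutNests t c := by
    refine mem_cutNests.2 ⟨isNest_of_mem hi fun e he f hf => ?_, ?_⟩
    · exact (hfrom e ((hC e).1 he)).2.trans (hfrom f ((hC f).1 hf)).1
    · intro e he f hf hadj g hg
      by_contra hlt
      rw [not_lt] at hlt
      exact he ((hC e).2 (((hC f).1 hf).tail ⟨hle f hf, hlt.trans (hle g hg), hadj.symm⟩))
  exact hle j (minNest_subset hmem hi hj)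

theorem subset_minNest_cutNests {c : Fin (n - 1) → α} {S : Finset (Fin (n - 1))}
    (hS : EdgeConnected t S) {i : Fin (n - 1)} (hi : i ∈ S) (h : ∀ j ∈ S, c j ≤ c i) :
    S ⊆ minNest (cutNests t c) i := by
  intro j hj
  refine mem_minNest.2 fun N hN hiN => ?_
  by_contra hjN
  obtain ⟨e, he, heN, f, hf, hfN, hadj⟩ := hS.exists_crossing hi hiN hj hjN
  exact absurd ((mem_cutNests.1 hN).2 e heN f hfN hadj i hiN) (not_lt.2 (h e he))

theorem isMaxNesting_cutNests (hn : 2 ≤ n) {c : Fin (n - 1) → α} (hc : Function.Injective c) :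
    IsMaxNesting t (cutNests t c) := by
  rw [isMaxNesting_iff hn]
  refine ⟨isNesting_cutNests hn c, fun i j hij => hc (le_antisymm ?_ ?_)⟩
  · exact le_of_mem_minNest_cutNests (t := t) (hij ▸ self_mem_minNest _ i)
  · exact le_of_mem_minNest_cutNests (t := t) (hij ▸ self_mem_minNest _ j)

theorem cutNests_subset_of_lt {β : Type*} [LinearOrder β] {c : Fin (n - 1) → α}
    {d : Fin (n - 1) → β} (h : ∀ i j, c i < c j → d i < d j) : cutNests t c ⊆ cutNests t d := by
  intro N hN
  rw [mem_cutNests] at *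
  exact ⟨hN.1, fun e he f hf hadj g hg => h _ _ (hN.2 e he f hf hadj g hg)⟩

end CutNests

theorem cutNests_card_minNest (hn : 2 ≤ n) {𝒩 : Finset (Finset (Fin (n - 1)))}
    (h : IsNesting t 𝒩) : cutNests t (fun i => (minNest 𝒩 i).card) = 𝒩 := by
  ext N
  constructor
  · intro hN
    rw [mem_cutNests] at hN
    obtain ⟨i, hi, hNi⟩ := h.exists_subset_minNest hN.1.2 (hN.1.nonempty hn)
    have : minNest 𝒩 i ⊆ N := by
      intro j hj
      by_contra hjN
      obtain ⟨e, he, heN, f, hf, hfN, hadj⟩ :=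
        (h.1 _ (h.minNest_mem i)).connected.exists_crossing (self_mem_minNest 𝒩 i) hi hj hjN
      exact absurd (hN.2 e heN f hfN hadj i hi)
        (not_lt.2 (Finset.card_le_card (minNest_subset (h.minNest_mem i) he)))
    rw [hNi.antisymm this]
    exact h.minNest_mem i
  · intro hN
    refine mem_cutNests.2 ⟨h.1 N hN, fun e he f hf hadj g hg => ?_⟩
    refine (Finset.card_le_card (minNest_subset hN hg)).trans_lt (Finset.card_lt_card ?_)
    rcases h.2.2 _ (h.minNest_mem e) N hN with h1 | h1 | h1
    · exact absurd (h1 (self_mem_minNest 𝒩 e)) he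
    · exact Finset.ssubset_iff_subset_ne.2 ⟨h1, fun h2 => he (h2 ▸ self_mem_minNest 𝒩 e)⟩
    · exact absurd hadj (h1.2 e (self_mem_minNest 𝒩 e) f hf)

/-- Every nesting refines to a maximal one obtained from an injective function, which may be
chosen to break one tie in a prescribed way. -/
theorem IsNesting.exists_injective (hn : 2 ≤ n) {𝒩 : Finset (Finset (Fin (n - 1)))}
    (h : IsNesting t 𝒩) (τ : Fin (n - 1) ≃ Fin (n - 1)) :
    ∃ d : Fin (n - 1) → ℕ, Function.Injective d ∧ 𝒩 ⊆ cutNests t d ∧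
      ∀ i j, (minNest 𝒩 i).card ≤ (minNest 𝒩 j).card → τ i < τ j → d i < d j := by
  have hlt : ∀ a b x y : ℕ, a < b → x < n → a * n + x < b * n + y := by
    intro a b x y hab hx
    have : (a + 1) * n ≤ b * n := Nat.mul_le_mul_right _ hab
    rw [Nat.add_mul] at this
    omega
  have hτ : ∀ i, (τ i).val < n := fun i => by have := (τ i).isLt; omega
  refine ⟨fun i => (minNest 𝒩 i).card * n + (τ i).val, ?_, ?_, ?_⟩
  · intro i j hij
    simp only at hij
    rcases lt_trichotomy (minNest 𝒩 i).card (minNest 𝒩 j).card with h1 | h1 | h1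
    · exact absurd hij (hlt _ _ _ _ h1 (hτ i)).ne
    · rw [h1] at hij
      exact τ.injective (Fin.ext (by omega))
    · exact absurd hij (hlt _ _ _ _ h1 (hτ j)).ne'
  · conv_lhs => rw [← cutNests_card_minNest hn h]
    exact cutNests_subset_of_lt fun i j hij => hlt _ _ _ _ hij (hτ i)
  · intro i j hij hlt'
    have := Nat.mul_le_mul_right n hij
    rw [Fin.lt_def] at hlt'
    simp only
    omega

theorem IsMaxNesting.exists_eq_cutNests (hn : 2 ≤ n) {𝒦 : Finset (Finset (Fin (n - 1)))}
    (h : IsMaxNesting t 𝒦) : ∃ d : Fin (n - 1) → ℕ, Function.Injective d ∧ 𝒦 = cutNests t d := by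
  obtain ⟨d, hd, hK, -⟩ := h.1.exists_injective hn (Equiv.refl _)
  exact ⟨d, hd, h.eq_of_subset hn (isNesting_cutNests hn d) hK⟩

theorem IsNesting.exists_isMaxNesting (hn : 2 ≤ n) {𝒩 : Finset (Finset (Fin (n - 1)))}
    (h : IsNesting t 𝒩) : ∃ 𝒦, IsMaxNesting t 𝒦 ∧ 𝒩 ⊆ 𝒦 := by
  obtain ⟨d, hd, hK, -⟩ := h.exists_injective hn (Equiv.refl _)
  exact ⟨_, isMaxNesting_cutNests hn hd, hK⟩

/-- A nesting is the intersection of the maximal nestings containing it. -/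
theorem IsNesting.mem_of_forall (hn : 2 ≤ n) {𝒩 : Finset (Finset (Fin (n - 1)))}
    (h : IsNesting t 𝒩) {N : Finset (Fin (n - 1))}
    (hN : ∀ 𝒦, IsMaxNesting t 𝒦 → 𝒩 ⊆ 𝒦 → N ∈ 𝒦) : N ∈ 𝒩 := by
  by_contra hN'
  obtain ⟨𝒦, hK, hNK⟩ := h.exists_isMaxNesting hn
  have hNn := hK.1.1 N (hN 𝒦 hK hNK)
  rw [← cutNests_card_minNest hn h, mem_cutNests] at hN'
  push Not at hN'
  obtain ⟨e, he, f, hf, hadj, g, hg, hle⟩ := hN' hNn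
  have hge : g ≠ e := by rintro rfl; exact he hg
  obtain ⟨τ, hτ⟩ : ∃ τ : Fin (n - 1) ≃ Fin (n - 1), τ e < τ g := by
    rcases lt_or_gt_of_ne hge with h1 | h1
    · exact ⟨Equiv.swap g e, by simpa using h1⟩
    · exact ⟨Equiv.refl _, h1⟩
  obtain ⟨d, hd, hNd, hlt⟩ := h.exists_injective hn τ
  have h1 := hN _ (isMaxNesting_cutNests hn hd) hNd
  exact absurd ((mem_cutNests.1 h1).2 e he f hf hadj g hg) (not_lt.2 (hlt e g hle hτ).le)

end Nestings

section ConvexGeometry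

variable {m : ℕ}

/-- The scalar product with a fixed vector, as a linear functional. -/
def dotLin (c : Vec m) : Vec m →ₗ[ℝ] ℝ where
  toFun := dot c
  map_add' x y := by simp [dot, mul_add, Finset.sum_add_distrib]
  map_smul' a x := by simp only [dot, Finset.mul_sum, Pi.smul_apply, smul_eq_mul, RingHom.id_apply]
                      exact Finset.sum_congr rfl fun i _ => by ring

@[simp] theorem dotLin_apply (c x : Vec m) : dotLin c x = dot c x := rfl

theorem exists_eq_dotLin (φ : Vec m →ₗ[ℝ] ℝ) : ∃ c, φ = dotLin c := by
  refine ⟨fun i => φ (Pi.single i 1), LinearMap.pi_ext fun i x => ?_⟩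
  have h : Pi.single i x = x • (Pi.single i 1 : Vec m) := by
    ext j; by_cases hj : j = i
    · subst hj; simp
    · simp [hj]
  rw [dotLin_apply, h, map_smul, ← dotLin_apply, map_smul]
  congr 1
  simp [dot, Pi.single_apply]

theorem sep_max_convexHull {S : Set (Vec m)} {c s₀ : Vec m} (hs₀ : s₀ ∈ S)
    (h : ∀ s ∈ S, dot c s ≤ dot c s₀) :
    {x ∈ convexHull ℝ S | ∀ y ∈ convexHull ℝ S, dot c y ≤ dot c x} =
      convexHull ℝ {s ∈ S | dot c s₀ ≤ dot c s} := by
  set T := {s ∈ S | dot c s₀ ≤ dot c s}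
  have hTmax : ∀ x ∈ convexHull ℝ T, dot c x = dot c s₀ := by
    intro x hx
    have : convexHull ℝ T ⊆ {x | dotLin c x = dot c s₀} :=
      convexHull_min (fun s hs => le_antisymm (h s hs.1) hs.2)
        (convex_hyperplane (dotLin c).isLinear _)
    exact this hx
  have hle : ∀ x ∈ convexHull ℝ S, dot c x ≤ dot c s₀ := by
    intro x hx
    have : convexHull ℝ S ⊆ {x | dotLin c x ≤ dot c s₀} :=
      convexHull_min h (convex_halfSpace_le (dotLin c).isLinear _)
    exact this hx
  have hcover : convexHull ℝ S ⊆ {x | dot c x < dot c s₀} ∪ convexHull ℝ T := by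
    refine convexHull_min ?_ ?_
    · intro s hs
      rcases lt_or_ge (dot c s) (dot c s₀) with h1 | h1
      · exact Or.inl h1
      · exact Or.inr (subset_convexHull ℝ T ⟨hs, h1⟩)
    · rw [convex_iff_forall_pos]
      intro x hx y hy a b ha hb hab
      have hxle : dot c x ≤ dot c s₀ := hx.elim (fun h => le_of_lt h) fun h => (hTmax x h).le
      have hyle : dot c y ≤ dot c s₀ := hy.elim (fun h => le_of_lt h) fun h => (hTmax y h).le
      have hd : dot c (a • x + b • y) = a * dot c x + b * dot c y := by
        rw [← dotLin_apply, map_add, map_smul, map_smul]; rfl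
      have hmix : dot c s₀ = a * dot c s₀ + b * dot c s₀ := by rw [← add_mul, hab, one_mul]
      rcases hx with hx | hx
      · left
        rw [Set.mem_ofPred_eq] at hx ⊢
        rw [hd, hmix]
        exact add_lt_add_of_lt_of_le (mul_lt_mul_of_pos_left hx ha)
          (mul_le_mul_of_nonneg_left hyle hb.le)
      · rcases hy with hy | hy
        · left
          rw [Set.mem_ofPred_eq] at hy ⊢
          rw [hd, hmix]
          exact add_lt_add_of_le_of_lt (mul_le_mul_of_nonneg_left hxle ha.le)
            (mul_lt_mul_of_pos_left hy hb)
        · exact Or.inr (convex_convexHull ℝ T hx hy ha.le hb.le hab)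
  ext x
  constructor
  · rintro ⟨hx, hmax⟩
    rcases hcover hx with h1 | h1
    · exact absurd (hmax s₀ (subset_convexHull ℝ S hs₀)) (not_le.2 h1)
    · exact h1
  · intro hx
    refine ⟨convexHull_mono (fun s hs => hs.1) hx, fun y hy => ?_⟩
    rw [hTmax x hx]
    exact hle y hy

end ConvexGeometry

section Vertices

variable {n : ℕ} {t : PTree n}

theorem MPoint_apply (𝒩 : Finset (Finset (Fin (n - 1)))) (h : IsNesting t 𝒩) (ω : Fin n → ℤ)
    (i : Fin (n - 1)) :
    MPoint t 𝒩 ω i = ∑ u, ∑ v, if isAnc t (childV i) u ∧ ¬ isAnc t (childV i) v ∧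
      pathEdges t u v ⊆ minNest 𝒩 i then (ω u : ℝ) * ω v else 0 := by
  have hconn := (h.1 _ (h.minNest_mem i)).connected
  have hfil : ∀ (V : Finset (Fin n)) (p : Fin n → Prop) [DecidablePred p],
      V.filter p = Finset.univ.filter fun w => w ∈ V ∧ p w := by
    intro V p _; ext; simp
  simp only [MPoint, alphaN, betaN, Int.cast_sum]
  rw [hfil _ (fun w => isAnc t (childV i) w), hfil _ (fun w => ¬ isAnc t (childV i) w),
    Finset.sum_filter, Finset.sum_filter, Finset.sum_mul_sum]
  refine Finset.sum_congr rfl fun u _ => Finset.sum_congr rfl fun v _ => ?_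
  rw [ite_zero_mul_ite_zero]
  refine if_congr ?_ rfl rfl
  constructor
  · rintro ⟨⟨hu, hu'⟩, hv, hv'⟩
    exact ⟨hu', hv', pathEdges_subset hconn hu hv⟩
  · rintro ⟨hu', hv', hp⟩
    have hne : u ≠ v := by rintro rfl; exact hv' hu'
    obtain ⟨hu, hv⟩ := mem_nestVtx_of_pathEdges_subset hne hp
    exact ⟨⟨hu, hu'⟩, hv, hv'⟩

theorem two_mul_MPoint_apply {𝒩 : Finset (Finset (Fin (n - 1)))} (h : IsNesting t 𝒩)
    (ω : Fin n → ℤ) (i : Fin (n - 1)) :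
    2 * MPoint t 𝒩 ω i = ∑ u, ∑ v, if i ∈ pathEdges t u v ∧ pathEdges t u v ⊆ minNest 𝒩 i
      then (ω u : ℝ) * ω v else 0 := by
  have h1 := MPoint_apply 𝒩 h ω i
  have h2 := h1
  rw [Finset.sum_comm] at h2
  rw [two_mul]
  nth_rewrite 1 [h1]
  rw [h2, ← Finset.sum_add_distrib]
  refine Finset.sum_congr rfl fun u _ => ?_
  rw [← Finset.sum_add_distrib]
  refine Finset.sum_congr rfl fun v _ => ?_
  simp only [mem_pathEdges, pathEdges_comm v u]
  by_cases hu : isAnc t (childV i) u <;> by_cases hv : isAnc t (childV i) v <;>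
    by_cases hp : pathEdges t u v ⊆ minNest 𝒩 i <;> simp [hu, hv, hp, mul_comm]

variable (t) in
/-- The value of `c` at the edge of the path from `u` to `v` whose smallest nest in `𝒦` contains
the whole path. -/
def topValue (𝒦 : Finset (Finset (Fin (n - 1)))) (c : Vec (n - 1)) (u v : Fin n) : ℝ :=
  ∑ i, if i ∈ pathEdges t u v ∧ pathEdges t u v ⊆ minNest 𝒦 i then c i else 0

theorem topValue_self (𝒦 : Finset (Finset (Fin (n - 1)))) (c : Vec (n - 1)) (u : Fin n) :
    topValue t 𝒦 c u u = 0 := by simp [topValue, pathEdges_self]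

theorem topValue_eq {𝒦 : Finset (Finset (Fin (n - 1)))} (hn : 2 ≤ n) (h : IsMaxNesting t 𝒦)
    {u v : Fin n} {i : Fin (n - 1)} (hi : i ∈ pathEdges t u v)
    (hp : pathEdges t u v ⊆ minNest 𝒦 i) (c : Vec (n - 1)) : topValue t 𝒦 c u v = c i := by
  rw [topValue, Finset.sum_eq_single i]
  · rw [if_pos ⟨hi, hp⟩]
  · intro j _ hj
    refine if_neg fun ⟨hj', hp'⟩ => hj ?_
    exact ((isMaxNesting_iff hn).1 h).2 (minNest_eq_of_mem h.1 (hp hj') (hp' hi))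
  · simp

theorem IsNesting.exists_top {𝒩 : Finset (Finset (Fin (n - 1)))} (h : IsNesting t 𝒩)
    {u v : Fin n} (huv : u ≠ v) : ∃ i ∈ pathEdges t u v, pathEdges t u v ⊆ minNest 𝒩 i :=
  h.exists_subset_minNest (edgeConnected_pathEdges u v) (pathEdges_nonempty huv)

theorem two_mul_dot_MPoint {𝒩 : Finset (Finset (Fin (n - 1)))} (h : IsNesting t 𝒩)
    (ω : Fin n → ℤ) (c : Vec (n - 1)) :
    2 * dot c (MPoint t 𝒩 ω) = ∑ u, ∑ v, (ω u : ℝ) * ω v * topValue t 𝒩 c u v := by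
  have h1 : ∀ i, 2 * (c i * MPoint t 𝒩 ω i) = ∑ u, ∑ v, (ω u : ℝ) * ω v *
      if i ∈ pathEdges t u v ∧ pathEdges t u v ⊆ minNest 𝒩 i then c i else 0 := by
    intro i
    rw [mul_left_comm, two_mul_MPoint_apply h]
    simp only [Finset.mul_sum]
    refine Finset.sum_congr rfl fun u _ => Finset.sum_congr rfl fun v _ => ?_
    split_ifs <;> ring
  simp only [dot, topValue, Finset.mul_sum, h1]
  rw [Finset.sum_comm]
  exact Finset.sum_congr rfl fun u _ => Finset.sum_comm

theorem topValue_le (hn : 2 ≤ n) {𝒦 𝒦₀ : Finset (Finset (Fin (n - 1)))} {c : Vec (n - 1)}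
    (h : IsMaxNesting t 𝒦) (h₀ : IsMaxNesting t 𝒦₀) (hc : cutNests t c ⊆ 𝒦₀) (u v : Fin n) :
    topValue t 𝒦 c u v ≤ topValue t 𝒦₀ c u v := by
  by_cases huv : u = v
  · subst huv; rw [topValue_self, topValue_self]
  obtain ⟨i, hi, hp⟩ := h.1.exists_top huv
  obtain ⟨j, hj, hp'⟩ := h₀.1.exists_top huv
  rw [topValue_eq hn h hi hp, topValue_eq hn h₀ hj hp']
  exact le_of_mem_minNest_cutNests (t := t) (minNest_anti hc j (hp' hi))

theorem dot_MPoint_le (hn : 2 ≤ n) {ω : Fin n → ℤ} (hω : ∀ j, 0 < ω j)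
    {𝒦 𝒦₀ : Finset (Finset (Fin (n - 1)))} {c : Vec (n - 1)}
    (h : IsMaxNesting t 𝒦) (h₀ : IsMaxNesting t 𝒦₀) (hc : cutNests t c ⊆ 𝒦₀) :
    dot c (MPoint t 𝒦 ω) ≤ dot c (MPoint t 𝒦₀ ω) := by
  have hω' : ∀ j, (0 : ℝ) < ω j := fun j => by exact_mod_cast hω j
  suffices 2 * dot c (MPoint t 𝒦 ω) ≤ 2 * dot c (MPoint t 𝒦₀ ω) by linarith
  rw [two_mul_dot_MPoint h.1, two_mul_dot_MPoint h₀.1]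
  exact Finset.sum_le_sum fun u _ => Finset.sum_le_sum fun v _ =>
    mul_le_mul_of_nonneg_left (topValue_le hn h h₀ hc u v) (mul_pos (hω' u) (hω' v)).le

theorem cutNests_subset_of_dot_le (hn : 2 ≤ n) {ω : Fin n → ℤ} (hω : ∀ j, 0 < ω j)
    {𝒦 𝒦₀ : Finset (Finset (Fin (n - 1)))} {c : Vec (n - 1)}
    (h : IsMaxNesting t 𝒦) (h₀ : IsMaxNesting t 𝒦₀) (hc : cutNests t c ⊆ 𝒦₀)
    (hle : dot c (MPoint t 𝒦₀ ω) ≤ dot c (MPoint t 𝒦 ω)) : cutNests t c ⊆ 𝒦 := by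
  have hω' : ∀ j, (0 : ℝ) < ω j := fun j => by exact_mod_cast hω j
  have hterm : ∀ u v, (ω u : ℝ) * ω v * topValue t 𝒦 c u v ≤
      (ω u : ℝ) * ω v * topValue t 𝒦₀ c u v := fun u v =>
    mul_le_mul_of_nonneg_left (topValue_le hn h h₀ hc u v) (mul_pos (hω' u) (hω' v)).le
  have heq : ∀ u v, topValue t 𝒦 c u v = topValue t 𝒦₀ c u v := by
    have hs : 2 * dot c (MPoint t 𝒦 ω) = 2 * dot c (MPoint t 𝒦₀ ω) := by
      rw [le_antisymm (dot_MPoint_le hn hω h h₀ hc) hle]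
    rw [two_mul_dot_MPoint h.1, two_mul_dot_MPoint h₀.1,
      Finset.sum_eq_sum_iff_of_le fun u _ => Finset.sum_le_sum fun v _ => hterm u v] at hs
    intro u v
    have hu := hs u (Finset.mem_univ _)
    rw [Finset.sum_eq_sum_iff_of_le fun v _ => hterm u v] at hu
    exact mul_left_cancel₀ (mul_pos (hω' u) (hω' v)).ne' (hu v (Finset.mem_univ _))
  intro N hN
  have hN' := mem_cutNests.1 hN
  obtain ⟨i, hi, hNi⟩ := h.1.exists_subset_minNest hN'.1.connected (hN'.1.nonempty hn)
  have hconn := (h.1.1 _ (h.1.minNest_mem i)).connected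
  have hmax : ∀ e ∈ minNest 𝒦 i, c e ≤ c i := by
    intro e he
    obtain ⟨u, hu, v, hv, hiu, heu⟩ :=
      exists_pathEdges_mem_mem (t := t) (self_mem_minNest 𝒦 i) he
    have huv : u ≠ v := by rintro rfl; simp [pathEdges_self] at hiu
    obtain ⟨j, hj, hp⟩ := h₀.1.exists_top huv
    rw [← topValue_eq hn h hiu (pathEdges_subset hconn hu hv) c, heq, topValue_eq hn h₀ hj hp]
    exact le_of_mem_minNest_cutNests (t := t) (minNest_anti hc j (hp heu))
  have hsub : minNest 𝒦 i ⊆ N := by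
    intro j hj
    by_contra hjN
    obtain ⟨e, he, heN, f, hf, hfN, hadj⟩ :=
      hconn.exists_crossing (self_mem_minNest 𝒦 i) hi hj hjN
    exact absurd (hN'.2 e heN f hfN hadj i hi) (not_lt.2 (hmax e he))
  rw [hNi.antisymm hsub]
  exact h.1.minNest_mem i

end Vertices

section Faces

variable {n : ℕ} {t : PTree n} {ω : Fin n → ℤ}

theorem sep_max_Loday (hn : 2 ≤ n) (hω : ∀ j, 0 < ω j) (c : Vec (n - 1)) :
    {x ∈ Loday t ω | ∀ y ∈ Loday t ω, dot c y ≤ dot c x} =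
      faceOfNesting t ω (cutNests t c) := by
  obtain ⟨𝒦₀, h₀, hc⟩ := (isNesting_cutNests (t := t) hn c).exists_isMaxNesting hn
  rw [Loday, sep_max_convexHull (s₀ := MPoint t 𝒦₀ ω), faceOfNesting]
  · congr 1
    ext x
    constructor
    · rintro ⟨⟨𝒦, h, rfl⟩, hle⟩
      exact ⟨𝒦, h, cutNests_subset_of_dot_le hn hω h h₀ hc hle, rfl⟩
    · rintro ⟨𝒦, h, hc', rfl⟩
      exact ⟨⟨𝒦, h, rfl⟩, dot_MPoint_le hn hω h₀ h hc'⟩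
  · exact ⟨𝒦₀, h₀, rfl⟩
  · rintro _ ⟨𝒦, h, rfl⟩
    exact dot_MPoint_le hn hω h h₀ hc

/-- A functional whose maximum over the Loday realization is attained on the face of `𝒩`. -/
def nestingFunctional (𝒩 : Finset (Finset (Fin (n - 1)))) : Vec (n - 1) :=
  fun i => ((minNest 𝒩 i).card : ℝ)

theorem cutNests_nestingFunctional (hn : 2 ≤ n) {𝒩 : Finset (Finset (Fin (n - 1)))}
    (h : IsNesting t 𝒩) : cutNests t (nestingFunctional 𝒩) = 𝒩 := by
  conv_rhs => rw [← cutNests_card_minNest hn h]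
  exact (cutNests_subset_of_lt fun i j hij => by simpa [nestingFunctional] using hij).antisymm
    (cutNests_subset_of_lt fun i j hij => by simpa [nestingFunctional] using hij)

theorem isFace_faceOfNesting (hn : 2 ≤ n) (hω : ∀ j, 0 < ω j)
    {𝒩 : Finset (Finset (Fin (n - 1)))} (h : IsNesting t 𝒩) :
    IsFace (Loday t ω) (faceOfNesting t ω 𝒩) :=
  ⟨nestingFunctional 𝒩, by rw [sep_max_Loday hn hω, cutNests_nestingFunctional hn h]⟩

theorem faceOfNesting_nonempty (hn : 2 ≤ n) {𝒩 : Finset (Finset (Fin (n - 1)))}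
    (h : IsNesting t 𝒩) : (faceOfNesting t ω 𝒩).Nonempty := by
  obtain ⟨𝒦, hK, hNK⟩ := h.exists_isMaxNesting hn
  exact ⟨_, subset_convexHull ℝ _ ⟨𝒦, hK, hNK, rfl⟩⟩

theorem exists_eq_faceOfNesting (hn : 2 ≤ n) (hω : ∀ j, 0 < ω j) {F : Set (Vec (n - 1))}
    (hF : IsFace (Loday t ω) F) : ∃ 𝒩, IsNesting t 𝒩 ∧ F = faceOfNesting t ω 𝒩 := by
  obtain ⟨c, rfl⟩ := hF
  exact ⟨_, isNesting_cutNests hn c, sep_max_Loday hn hω c⟩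

theorem faceOfNesting_anti {𝒩 𝒩' : Finset (Finset (Fin (n - 1)))} (h : 𝒩' ⊆ 𝒩) :
    faceOfNesting t ω 𝒩 ⊆ faceOfNesting t ω 𝒩' :=
  convexHull_mono fun _ ⟨𝒦, hK, hNK, hx⟩ => ⟨𝒦, hK, h.trans hNK, hx⟩

theorem subset_of_MPoint_mem (hn : 2 ≤ n) (hω : ∀ j, 0 < ω j)
    {𝒩 𝒦 : Finset (Finset (Fin (n - 1)))} (h : IsNesting t 𝒩) (hK : IsMaxNesting t 𝒦)
    (hmem : MPoint t 𝒦 ω ∈ faceOfNesting t ω 𝒩) : 𝒩 ⊆ 𝒦 := by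
  obtain ⟨𝒦₀, h₀, hN₀⟩ := h.exists_isMaxNesting hn
  rw [← cutNests_nestingFunctional hn h, ← sep_max_Loday hn hω] at hmem
  rw [← cutNests_nestingFunctional hn h] at hN₀ ⊢
  exact cutNests_subset_of_dot_le hn hω hK h₀ hN₀
    (hmem.2 _ (subset_convexHull ℝ _ ⟨𝒦₀, h₀, rfl⟩))

theorem faceOfNesting_subset_iff (hn : 2 ≤ n) (hω : ∀ j, 0 < ω j)
    {𝒩 𝒩' : Finset (Finset (Fin (n - 1)))} (h : IsNesting t 𝒩) (h' : IsNesting t 𝒩') :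
    faceOfNesting t ω 𝒩 ⊆ faceOfNesting t ω 𝒩' ↔ 𝒩' ⊆ 𝒩 := by
  refine ⟨fun hsub N hN => h.mem_of_forall hn fun 𝒦 hK hNK => ?_, faceOfNesting_anti⟩
  exact subset_of_MPoint_mem hn hω h' hK (hsub (subset_convexHull ℝ _ ⟨𝒦, hK, hNK, rfl⟩)) hN

end Faces

section Dimension

variable {n : ℕ} {t : PTree n} {ω : Fin n → ℤ}

theorem dot_MPoint_congr (hn : 2 ≤ n) {𝒩 : Finset (Finset (Fin (n - 1)))} (h : IsNesting t 𝒩)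
    {c : Vec (n - 1)} (hc : ∀ i j, minNest 𝒩 i = minNest 𝒩 j → c i = c j)
    {𝒦 𝒦' : Finset (Finset (Fin (n - 1)))} (hK : IsMaxNesting t 𝒦) (hK' : IsMaxNesting t 𝒦')
    (hN : 𝒩 ⊆ 𝒦) (hN' : 𝒩 ⊆ 𝒦') : dot c (MPoint t 𝒦 ω) = dot c (MPoint t 𝒦' ω) := by
  suffices 2 * dot c (MPoint t 𝒦 ω) = 2 * dot c (MPoint t 𝒦' ω) by linarith
  rw [two_mul_dot_MPoint hK.1, two_mul_dot_MPoint hK'.1]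
  refine Finset.sum_congr rfl fun u _ => Finset.sum_congr rfl fun v _ => ?_
  congr 1
  by_cases huv : u = v
  · subst huv; rw [topValue_self, topValue_self]
  obtain ⟨i, hi, hp⟩ := hK.1.exists_top huv
  obtain ⟨j, hj, hp'⟩ := hK'.1.exists_top huv
  rw [topValue_eq hn hK hi hp, topValue_eq hn hK' hj hp']
  exact hc i j (minNest_eq_of_mem h (minNest_anti hN' j (hp' hi)) (minNest_anti hN i (hp hj)))

theorem eq_of_dot_MPoint_congr (hn : 2 ≤ n) (hω : ∀ j, 0 < ω j)
    {𝒩 : Finset (Finset (Fin (n - 1)))} (h : IsNesting t 𝒩) {c : Vec (n - 1)}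
    (hc : ∀ 𝒦 𝒦', IsMaxNesting t 𝒦 → IsMaxNesting t 𝒦' → 𝒩 ⊆ 𝒦 → 𝒩 ⊆ 𝒦' →
      dot c (MPoint t 𝒦 ω) = dot c (MPoint t 𝒦' ω))
    {i j : Fin (n - 1)} (hij : minNest 𝒩 i = minNest 𝒩 j) : c i = c j := by
  set K : ℝ := 2 * ∑ i, |c i| + 1
  set d : Vec (n - 1) := K • nestingFunctional 𝒩 + c
  have habs : ∀ i, |c i| ≤ ∑ i, |c i| := fun i =>
    Finset.single_le_sum (f := fun i => |c i|) (fun i _ => abs_nonneg _) (Finset.mem_univ i)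
  have hsub : 𝒩 ⊆ cutNests t d := by
    conv_lhs => rw [← cutNests_card_minNest hn h]
    refine cutNests_subset_of_lt fun i j hij => ?_
    have h1 : ((minNest 𝒩 i).card : ℝ) + 1 ≤ (minNest 𝒩 j).card := by exact_mod_cast hij
    have h2 := abs_le.1 (habs i)
    have h3 := abs_le.1 (habs j)
    simp only [d, K, Pi.add_apply, Pi.smul_apply, smul_eq_mul, nestingFunctional]
    nlinarith
  obtain ⟨𝒦₀, h₀, hd₀⟩ := (isNesting_cutNests (t := t) hn d).exists_isMaxNesting hn
  have hN₀ := hsub.trans hd₀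
  have hddot : ∀ x, dot d x = K * dot (nestingFunctional 𝒩) x + dot c x := by
    intro x
    simp only [dot, d, Finset.mul_sum, ← Finset.sum_add_distrib, Pi.add_apply, Pi.smul_apply,
      smul_eq_mul]
    exact Finset.sum_congr rfl fun i _ => by ring
  have heq : cutNests t d = 𝒩 := by
    refine Finset.Subset.antisymm (fun N hN => h.mem_of_forall hn fun 𝒦 hK hNK => ?_) hsub
    refine cutNests_subset_of_dot_le hn hω hK h₀ hd₀ ?_ hN
    rw [hddot, hddot, hc 𝒦 𝒦₀ hK h₀ hNK hN₀, dot_MPoint_congr hn h _ hK h₀ hNK hN₀]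
    intro i j hij
    simp only [nestingFunctional, hij]
  have hdij : d i = d j := by
    refine le_antisymm ?_ ?_
    · refine le_of_mem_minNest_cutNests (t := t) ?_
      rw [heq, ← hij]; exact self_mem_minNest _ _
    · refine le_of_mem_minNest_cutNests (t := t) ?_
      rw [heq, hij]; exact self_mem_minNest _ _
  simpa [d, nestingFunctional, hij] using hdij

theorem sdim_faceOfNesting (hn : 2 ≤ n) (hω : ∀ j, 0 < ω j)
    {𝒩 : Finset (Finset (Fin (n - 1)))} (h : IsNesting t 𝒩) :
    sdim (faceOfNesting t ω 𝒩) + 𝒩.card = n - 1 := by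
  set S := {x | ∃ 𝒦, IsMaxNesting t 𝒦 ∧ 𝒩 ⊆ 𝒦 ∧ x = MPoint t 𝒦 ω} with hS
  let Φ : Vec (n - 1) →ₗ[ℝ] ({N // N ∈ 𝒩} → ℝ) :=
    LinearMap.pi fun N => dotLin fun i => if minNest 𝒩 i = N.1 then 1 else 0
  have hΦ : Function.Surjective Φ := by
    intro y
    choose s hs hs' using fun N : {N // N ∈ 𝒩} => h.exists_eq_minNest hn N.2
    refine ⟨fun i => if s ⟨_, h.minNest_mem i⟩ = i then y ⟨_, h.minNest_mem i⟩ else 0, ?_⟩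
    ext N
    simp only [Φ, LinearMap.pi_apply, dotLin_apply, dot]
    rw [Finset.sum_eq_single (s N)]
    · have : (⟨minNest 𝒩 (s N), h.minNest_mem _⟩ : {N // N ∈ 𝒩}) = N := Subtype.ext (hs' N)
      simp [hs' N]
    · intro i _ hi
      by_cases h1 : minNest 𝒩 i = N.1
      · have : (⟨minNest 𝒩 i, h.minNest_mem _⟩ : {N // N ∈ 𝒩}) = N := Subtype.ext h1
        rw [this, if_neg (Ne.symm hi), mul_zero]
      · rw [if_neg h1, zero_mul]
    · simp
  have hdir : (affineSpan ℝ (faceOfNesting t ω 𝒩)).direction = LinearMap.ker Φ := by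
    rw [faceOfNesting, affineSpan_convexHull, direction_affineSpan, ← hS]
    apply le_antisymm
    · rw [vectorSpan_def, Submodule.span_le]
      rintro _ ⟨_, ⟨𝒦, hK, hN, rfl⟩, _, ⟨𝒦', hK', hN', rfl⟩, rfl⟩
      change Φ (MPoint t 𝒦 ω - MPoint t 𝒦' ω) = 0
      rw [map_sub, sub_eq_zero]
      ext N
      simp only [Φ, LinearMap.pi_apply, dotLin_apply]
      exact dot_MPoint_congr hn h (fun i j hij => by simp only [hij]) hK hK' hN hN'
    · intro x hx
      rw [← Subspace.forall_mem_dualAnnihilator_apply_eq_zero_iff]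
      intro φ hφ
      obtain ⟨c, rfl⟩ := exists_eq_dotLin φ
      rw [Submodule.mem_dualAnnihilator] at hφ
      have hc : ∀ i j, minNest 𝒩 i = minNest 𝒩 j → c i = c j := fun i j =>
        eq_of_dot_MPoint_congr hn hω h fun 𝒦 𝒦' hK hK' hN hN' => by
          have := hφ _ (vsub_mem_vectorSpan ℝ (s := S) ⟨𝒦, hK, hN, rfl⟩ ⟨𝒦', hK', hN', rfl⟩)
          rwa [vsub_eq_sub, map_sub, sub_eq_zero] at this
      choose s hs hs' using fun N : {N // N ∈ 𝒩} => h.exists_eq_minNest hn N.2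
      have hdot : dot c x = ∑ N, c (s N) * Φ x N := by
        simp only [Φ, LinearMap.pi_apply, dotLin_apply, dot, Finset.mul_sum]
        rw [Finset.sum_comm]
        refine Finset.sum_congr rfl fun i _ => ?_
        rw [Finset.sum_eq_single ⟨_, h.minNest_mem i⟩]
        · rw [hc (s ⟨_, h.minNest_mem i⟩) i (hs' _)]
          simp
        · intro N _ hN
          rw [if_neg fun h' => hN (Subtype.ext h'.symm)]
          simp
        · simp
      rw [dotLin_apply, hdot, LinearMap.mem_ker.1 hx]
      simp
  have hrank := LinearMap.finrank_range_add_finrank_ker Φ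
  rw [LinearMap.range_eq_top.2 hΦ, finrank_top, Module.finrank_fintype_fun_eq_card,
    Module.finrank_fintype_fun_eq_card, Fintype.card_coe, Fintype.card_fin, add_comm] at hrank
  rw [sdim, hdir]
  exact hrank

end Dimension

section Pullback

variable {n m : ℕ} {t : PTree n}

theorem exists_iterate_iff_isAnc {g : Fin m → Fin n} (hg : StrictMono g) {p : Fin m → Fin m}
    (h0 : ∀ a, a.val = 0 → p a = a) (hlt : ∀ a, 0 < a.val → (p a).val < a.val)
    (hp : ∀ x a, 0 < a.val → (isAnc t (g x) (g a) ↔ x = a ∨ isAnc t (g x) (g (p a))))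
    (x a : Fin m) : (∃ k : ℕ, p^[k] a = x) ↔ isAnc t (g x) (g a) := by
  induction hm : a.val using Nat.strong_induction_on generalizing a with
  | _ l ih =>
    by_cases ha : a.val = 0
    · have hfix : ∀ k, p^[k] a = a := Function.iterate_fixed (h0 a ha)
      simp only [hfix, exists_const]
      constructor
      · rintro rfl; exact isAnc_refl t _
      · intro h
        have h1 : x ≤ a := hg.le_iff_le.1 (Fin.le_def.2 h.le)
        rw [Fin.le_def] at h1
        exact Fin.ext (by omega)
    · have hpos : 0 < a.val := by omega
      have hlt' := hlt a hpos
      rw [hp x a hpos, ← ih _ (by omega) (p a) rfl]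
      constructor
      · rintro ⟨k, hk⟩
        cases k with
        | zero => exact Or.inl hk.symm
        | succ k => exact Or.inr ⟨k, hk⟩
      · rintro (rfl | ⟨k, hk⟩)
        · exact ⟨0, rfl⟩
        · exact ⟨k + 1, hk⟩

/-- A parent function inducing the ancestor relation of `t` along an increasing relabelling
defines a planar tree. -/
theorem exists_pullback {g : Fin m → Fin n} (hg : StrictMono g) {p : Fin m → Fin m}
    (h0 : ∀ a, a.val = 0 → p a = a) (hlt : ∀ a, 0 < a.val → (p a).val < a.val)
    (hp : ∀ x a, 0 < a.val → (isAnc t (g x) (g a) ↔ x = a ∨ isAnc t (g x) (g (p a)))) :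
    ∃ s : PTree m, s.parent = p ∧ ∀ x a, isAnc s x a ↔ isAnc t (g x) (g a) := by
  have key := exists_iterate_iff_isAnc hg h0 hlt hp
  refine ⟨⟨p, h0, hlt, fun v w hw => ?_⟩, rfl, fun x a => ?_⟩
  · have h1 : isAnc t (g (p w)) (g w) := (key _ _).1 ⟨1, rfl⟩
    have h2 := hlt w (by omega)
    exact (key _ _).2 (h1.of_le (hg.monotone (Fin.le_def.2 (by omega)))
      (hg.monotone (Fin.le_def.2 (by omega))))
  · rw [isAnc_iff_exists]
    exact key x a

end Pullback

section NestRoot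

variable {n : ℕ} {t : PTree n} {N : Finset (Fin (n - 1))} {r : Fin n}

theorem mem_of_childV_mem (hN : EdgeConnected t N) (hr : r ∈ nestVtx t N)
    (hmin : ∀ u ∈ nestVtx t N, r ≤ u) {i : Fin (n - 1)} (hi : childV i ∈ nestVtx t N)
    (hne : childV i ≠ r) : i ∈ N := by
  refine pathEdges_subset hN hi hr (mem_pathEdges.2 ?_)
  have h1 : ¬ isAnc t (childV i) r := fun h =>
    hne (le_antisymm (Fin.le_def.2 h.le) (hmin _ hi))
  simp [isAnc_refl, h1]

theorem childV_ne_root (hmin : ∀ u ∈ nestVtx t N, r ≤ u) {i : Fin (n - 1)} (hi : i ∈ N) :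
    childV i ≠ r := by
  rintro rfl
  have h1 := Fin.le_def.1 (hmin _ (parent_mem_nestVtx hi))
  have h2 := parent_childV_lt t i
  omega

theorem parent_mem_of_mem (hN : EdgeConnected t N) (hr : r ∈ nestVtx t N)
    (hmin : ∀ u ∈ nestVtx t N, r ≤ u) {v : Fin n} (hv : v ∈ nestVtx t N) (hne : v ≠ r) :
    t.parent v ∈ nestVtx t N := by
  have h1 : r.val ≠ v.val := fun h => hne (Fin.ext h.symm)
  have h2 := Fin.le_def.1 (hmin v hv)
  have h0 : 0 < v.val := by omega
  have := mem_of_childV_mem hN hr hmin (i := edgeOf v h0) (by simpa using hv) (by simpa using hne)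
  simpa using parent_mem_nestVtx (t := t) this

theorem isAnc_root_of_mem (hN : EdgeConnected t N) (hr : r ∈ nestVtx t N)
    (hmin : ∀ u ∈ nestVtx t N, r ≤ u) {v : Fin n} (hv : v ∈ nestVtx t N) : isAnc t r v := by
  induction hm : v.val using Nat.strong_induction_on generalizing v with
  | _ l ih =>
    by_cases hne : v = r
    · exact hne ▸ isAnc_refl t v
    have h1 : r.val ≠ v.val := fun h => hne (Fin.ext h.symm)
    have h2 := Fin.le_def.1 (hmin v hv)
    have h0 : 0 < v.val := by omega
    have h3 := t.parent_lt v h0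
    exact (ih _ (by omega) (parent_mem_of_mem hN hr hmin hv hne) rfl).trans (isAnc_parent t v)

theorem isAnc_iff_isAnc_root (hN : EdgeConnected t N) (hr : r ∈ nestVtx t N)
    (hmin : ∀ u ∈ nestVtx t N, r ≤ u) {x v : Fin n}
    (hx : x ∈ insert r (Finset.univ \ nestVtx t N)) (hv : v ∈ nestVtx t N) :
    isAnc t x v ↔ isAnc t x r := by
  refine ⟨fun h => ?_, fun h => h.trans (isAnc_root_of_mem hN hr hmin hv)⟩
  simp only [Finset.mem_insert, Finset.mem_sdiff, Finset.mem_univ, true_and] at hx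
  rcases hx with rfl | hx
  · exact isAnc_refl t x
  by_contra hxr
  have h0 : 0 < x.val := by
    by_contra h0
    exact hxr (isAnc_of_val_eq_zero (by omega) r)
  refine hx ?_
  have : edgeOf x h0 ∈ N := pathEdges_subset hN hv hr (mem_pathEdges.2 (by simp [h, hxr]))
  simpa using childV_mem_nestVtx (t := t) this

end NestRoot

/-- The decomposition of a tree along a nest: the subtree spanned by the nest, the contracted tree,
their order-preserving relabellings and the induced shuffle of edges. -/
structure NestSplit {n : ℕ} (t : PTree n) (N : Finset (Fin (n - 1))) where
  k : ℕ
  r : Fin n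
  card_eq : (nestVtx t N).card = k
  r_mem : r ∈ nestVtx t N
  r_le : ∀ u ∈ nestVtx t N, r ≤ u
  sub : PTree k
  con : PTree (n - k + 1)
  e : Fin k ≃o {u : Fin n // u ∈ nestVtx t N}
  f : Fin (n - k + 1) ≃o {u : Fin n // u ∈ insert r (Finset.univ \ nestVtx t N)}
  σ : (Fin (n - k) ⊕ Fin (k - 1)) ≃ Fin (n - 1)
  sub_parent : ∀ b : Fin k, 0 < b.val → (e (sub.parent b)).1 = t.parent (e b).1
  con_parent : ∀ a : Fin (n - k + 1), 0 < a.val →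
    (f (con.parent a)).1 = if t.parent (f a).1 ∈ nestVtx t N then r else t.parent (f a).1
  childV_inr : ∀ b : Fin (k - 1), childV (σ (Sum.inr b)) = (e (childV b)).1
  childV_inl : ∀ a : Fin (n - k), childV (σ (Sum.inl a)) = (f (childV (n := n - k + 1) a)).1
  sub_isAnc : ∀ x b, isAnc sub x b ↔ isAnc t (e x).1 (e b).1
  con_isAnc : ∀ x a, isAnc con x a ↔ isAnc t (f x).1 (f a).1

theorem orderIso_val_pos {n m : ℕ} {s : Finset (Fin n)} (e : Fin m ≃o {u : Fin n // u ∈ s})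
    {b : Fin m} (hb : 0 < b.val) : 0 < (e b).1.val := by
  have h : e ⟨0, by have := b.isLt; omega⟩ < e b := e.strictMono (Fin.lt_def.2 hb)
  have h' : (e ⟨0, by have := b.isLt; omega⟩).1.val < (e b).1.val := h
  omega

theorem orderIso_ne_of_le {n m : ℕ} {s : Finset (Fin n)} (e : Fin m ≃o {u : Fin n // u ∈ s})
    {r : Fin n} (hr : ∀ u ∈ s, r ≤ u) {b : Fin m} (hb : 0 < b.val) : (e b).1 ≠ r := by
  have h : e ⟨0, by have := b.isLt; omega⟩ < e b := e.strictMono (Fin.lt_def.2 hb)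
  exact ((hr _ (e ⟨0, by have := b.isLt; omega⟩).2).trans_lt h).ne'

theorem nonempty_nestSplit {n : ℕ} (hn : 2 ≤ n) {t : PTree n} {N : Finset (Fin (n - 1))}
    (hN : IsNest t N) : Nonempty (NestSplit t N) := by
  classical
  have hconn := hN.connected
  have hVne : (nestVtx t N).Nonempty := by
    obtain ⟨i, hi⟩ := hN.nonempty hn
    exact ⟨_, childV_mem_nestVtx hi⟩
  obtain ⟨r, hr, hmin⟩ := Finset.exists_min_image (nestVtx t N) id hVne
  simp only [id] at hmin
  obtain ⟨k, hk⟩ : ∃ k, (nestVtx t N).card = k := ⟨_, rfl⟩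
  have hk1 : 1 ≤ k := hk ▸ hVne.card_pos
  have hkn : k ≤ n := by
    rw [← hk]
    exact (Finset.card_le_univ _).trans (by simp)
  have hcard : (insert r (Finset.univ \ nestVtx t N)).card = n - k + 1 := by
    rw [Finset.card_insert_of_notMem (by simp [hr]), Finset.card_sdiff_of_subset
      (Finset.subset_univ _), hk, Finset.card_univ, Fintype.card_fin]
  let e : Fin k ≃o {u : Fin n // u ∈ nestVtx t N} := Finset.orderIsoOfFin _ hk
  let f : Fin (n - k + 1) ≃o {u : Fin n // u ∈ insert r (Finset.univ \ nestVtx t N)} :=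
    Finset.orderIsoOfFin _ hcard
  have he : StrictMono fun b => (e b).1 := fun a b h => e.strictMono h
  have hf : StrictMono fun b => (f b).1 := fun a b h => f.strictMono h
  have hproj : ∀ v, (if v ∈ nestVtx t N then r else v) ∈
      insert r (Finset.univ \ nestVtx t N) := by
    intro v
    split_ifs with h <;> simp [h]
  have heN : ∀ b : Fin k, 0 < b.val → t.parent (e b).1 ∈ nestVtx t N := fun b hb =>
    parent_mem_of_mem hconn hr hmin (e b).2 (orderIso_ne_of_le e hmin hb)
  let psub : Fin k → Fin k := fun b =>
    if hb : 0 < b.val then e.symm ⟨t.parent (e b).1, heN b hb⟩ else b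
  let pcon : Fin (n - k + 1) → Fin (n - k + 1) := fun a =>
    if 0 < a.val then f.symm ⟨_, hproj (t.parent (f a).1)⟩ else a
  have hpsub : ∀ b : Fin k, 0 < b.val → (e (psub b)).1 = t.parent (e b).1 := by
    intro b hb
    simp only [psub, dif_pos hb, OrderIso.apply_symm_apply]
  have hpcon : ∀ a : Fin (n - k + 1), 0 < a.val → (f (pcon a)).1 =
      if t.parent (f a).1 ∈ nestVtx t N then r else t.parent (f a).1 := by
    intro a ha
    simp only [pcon, if_pos ha, OrderIso.apply_symm_apply]
  obtain ⟨sub, hsubp, hsub⟩ := exists_pullback (t := t) he (p := psub)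
    (fun a ha => by simp [psub, ha])
    (fun a ha => by
      rw [← Fin.lt_def, ← he.lt_iff_lt]
      simp only [hpsub a ha]
      exact Fin.lt_def.2 (t.parent_lt _ (orderIso_val_pos e ha)))
    (fun x a ha => by
      rw [isAnc_step, hpsub a ha, he.injective.eq_iff (a := x) (b := a)]
      simp [orderIso_val_pos e ha])
  obtain ⟨con, hconp, hcon⟩ := exists_pullback (t := t) hf (p := pcon)
    (fun a ha => if_neg (by omega))
    (fun a ha => by
      rw [← Fin.lt_def, ← hf.lt_iff_lt]
      simp only [hpcon a ha]
      have h1 := Fin.lt_def.2 (t.parent_lt _ (orderIso_val_pos f ha))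
      split_ifs with h
      · exact (hmin _ h).trans_lt h1
      · exact h1)
    (fun x a ha => by
      rw [isAnc_step, hpcon a ha, hf.injective.eq_iff (a := x) (b := a)]
      simp only [orderIso_val_pos f ha, true_and]
      refine or_congr_right ?_
      split_ifs with h
      · exact isAnc_iff_isAnc_root hconn hr hmin (f x).2 h
      · rfl)
  let s : Fin (n - k) ⊕ Fin (k - 1) → Fin (n - 1) := Sum.elim
    (fun a => edgeOf (f (childV (n := n - k + 1) a)).1 (orderIso_val_pos f (childV_pos _)))
    (fun b => edgeOf (e (childV b)).1 (orderIso_val_pos e (childV_pos _)))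
  have hsl : ∀ a, childV (s (Sum.inl a)) = (f (childV (n := n - k + 1) a)).1 := fun a =>
    childV_edgeOf _ (orderIso_val_pos f (childV_pos _))
  have hsr : ∀ b, childV (s (Sum.inr b)) = (e (childV b)).1 := fun b =>
    childV_edgeOf _ (orderIso_val_pos e (childV_pos _))
  have hdisj : ∀ a b, s (Sum.inl a) ≠ s (Sum.inr b) := by
    intro a b h
    have h1 := congrArg childV h
    rw [hsl, hsr] at h1
    have h2 := (f (childV (n := n - k + 1) a)).2
    rw [h1] at h2
    simp only [Finset.mem_insert, Finset.mem_sdiff, (e (childV b)).2, not_true, and_false,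
      or_false] at h2
    exact orderIso_ne_of_le e hmin (childV_pos b) h2
  have hs : Function.Bijective s := by
    rw [Fintype.bijective_iff_injective_and_card]
    constructor
    · rintro (a | b) (a' | b') h
      · have h1 := congrArg childV h
        rw [hsl, hsl] at h1
        rw [childV_injective (n := n - k + 1) (hf.injective h1)]
      · exact absurd h (hdisj a b')
      · exact absurd h.symm (hdisj a' b)
      · have h1 := congrArg childV h
        rw [hsr, hsr] at h1
        rw [childV_injective (he.injective h1)]
    · simp only [Fintype.card_sum, Fintype.card_fin]
      omega
  exact ⟨⟨k, r, hk, hr, hmin, sub, con, e, f, Equiv.ofBijective s hs, hsubp ▸ hpsub,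
    hconp ▸ hpcon, hsr, hsl, hsub, hcon⟩⟩

section OrderPoint

variable {n : ℕ} (t : PTree n) (ω : Fin n → ℤ) {α : Type*} [LinearOrder α]

/-- The point whose `i`-th coordinate collects the products of weights of the pairs of vertices
joined by a path on which `c` is maximal at the edge `i`. -/
def orderPoint (c : Fin (n - 1) → α) : Vec (n - 1) := fun i =>
  ∑ u, ∑ v, if isAnc t (childV i) u ∧ ¬ isAnc t (childV i) v ∧
    ∀ j ∈ pathEdges t u v, c j ≤ c i then (ω u : ℝ) * ω v else 0

variable {t ω}

theorem MPoint_cutNests (hn : 2 ≤ n) (c : Fin (n - 1) → α) :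
    MPoint t (cutNests t c) ω = orderPoint t ω c := by
  funext i
  rw [MPoint_apply _ (isNesting_cutNests hn c), orderPoint]
  refine Finset.sum_congr rfl fun u _ => Finset.sum_congr rfl fun v _ => if_congr ?_ rfl rfl
  refine and_congr_right fun hu => and_congr_right fun hv => ?_
  refine ⟨fun h j hj => le_of_mem_minNest_cutNests (h hj), fun h => ?_⟩
  exact subset_minNest_cutNests (edgeConnected_pathEdges u v) (mem_pathEdges.2 (by tauto)) h

theorem faceOfNesting_eq (hn : 2 ≤ n) (𝒩 : Finset (Finset (Fin (n - 1)))) :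
    faceOfNesting t ω 𝒩 = convexHull ℝ {x | ∃ c : Fin (n - 1) → ℕ, Function.Injective c ∧
      𝒩 ⊆ cutNests t c ∧ x = orderPoint t ω c} := by
  rw [faceOfNesting]
  congr 1
  ext x
  constructor
  · rintro ⟨𝒦, h, hs, rfl⟩
    obtain ⟨c, hc, rfl⟩ := h.exists_eq_cutNests hn
    exact ⟨c, hc, hs, MPoint_cutNests hn c⟩
  · rintro ⟨c, hc, hs, rfl⟩
    exact ⟨_, isMaxNesting_cutNests hn hc, hs, (MPoint_cutNests hn c).symm⟩

theorem Loday_eq_faceOfNesting : Loday t ω = faceOfNesting t ω {Finset.univ} := by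
  rw [Loday, faceOfNesting]
  congr 1
  ext x
  refine exists_congr fun 𝒦 => and_congr_right fun h => ?_
  simp [h.1.2.1]

theorem Loday_eq (hn : 2 ≤ n) :
    Loday t ω = convexHull ℝ {x | ∃ c : Fin (n - 1) → ℕ, Function.Injective c ∧
      x = orderPoint t ω c} := by
  rw [Loday_eq_faceOfNesting, faceOfNesting_eq hn]
  congr 1
  ext x
  refine exists_congr fun c => and_congr_right fun _ => ?_
  simp [(isNesting_cutNests hn c).2.1]

theorem orderPoint_congr {β : Type*} [LinearOrder β] {c : Fin (n - 1) → α}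
    {d : Fin (n - 1) → β} (h : ∀ i j, c i ≤ c j ↔ d i ≤ d j) :
    orderPoint t ω c = orderPoint t ω d := by
  funext i
  simp only [orderPoint, h]

end OrderPoint

namespace NestSplit

variable {n : ℕ} {t : PTree n} {N : Finset (Fin (n - 1))} (S : NestSplit t N)

theorem inr_mem (hN : EdgeConnected t N) (b : Fin (S.k - 1)) : S.σ (Sum.inr b) ∈ N :=
  mem_of_childV_mem hN S.r_mem S.r_le (S.childV_inr b ▸ (S.e _).2)
    (S.childV_inr b ▸ orderIso_ne_of_le S.e S.r_le (childV_pos b))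

theorem inl_notMem (a : Fin (n - S.k)) : S.σ (Sum.inl a) ∉ N := by
  intro h
  have h1 := childV_ne_root S.r_le h
  have h2 := childV_mem_nestVtx (t := t) h
  have h3 := (S.f (childV (n := n - S.k + 1) a)).2
  rw [← S.childV_inl] at h3
  simp only [Finset.mem_insert, Finset.mem_sdiff, h1, h2, not_true, and_false, or_false] at h3

theorem exists_inr {j : Fin (n - 1)} (hj : j ∈ N) :
    ∃ b, S.σ (Sum.inr b) = j := by
  obtain ⟨a | b, rfl⟩ := S.σ.surjective j
  · exact absurd hj (S.inl_notMem a)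
  · exact ⟨b, rfl⟩

theorem mk_mem (v : Fin n) : (if v ∈ nestVtx t N then S.r else v) ∈
    insert S.r (Finset.univ \ nestVtx t N) := by
  split_ifs with h <;> simp [h]

/-- The contraction map on vertices. -/
def proj (v : Fin n) : Fin (n - S.k + 1) := S.f.symm ⟨_, S.mk_mem v⟩

theorem f_proj (v : Fin n) : (S.f (S.proj v)).1 = if v ∈ nestVtx t N then S.r else v := by
  simp [proj]

theorem isAnc_proj (hN : EdgeConnected t N) (x : Fin (n - S.k + 1)) (v : Fin n) :
    isAnc S.con x (S.proj v) ↔ isAnc t (S.f x).1 v := by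
  rw [S.con_isAnc, f_proj]
  split_ifs with h
  · exact (isAnc_iff_isAnc_root hN S.r_mem S.r_le (S.f x).2 h).symm
  · rfl

theorem mem_pathEdges_sub (b : Fin (S.k - 1)) (x y : Fin S.k) :
    b ∈ pathEdges S.sub x y ↔ S.σ (Sum.inr b) ∈ pathEdges t (S.e x).1 (S.e y).1 := by
  rw [mem_pathEdges, mem_pathEdges, S.childV_inr, S.sub_isAnc, S.sub_isAnc]

theorem mem_pathEdges_con (hN : EdgeConnected t N) (a : Fin (n - S.k)) (u v : Fin n) :
    a ∈ pathEdges S.con (S.proj u) (S.proj v) ↔ S.σ (Sum.inl a) ∈ pathEdges t u v := by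
  rw [mem_pathEdges, mem_pathEdges, S.childV_inl, S.isAnc_proj hN, S.isAnc_proj hN]

/-- The weight on the contracted tree. -/
def conWeight (ω : Fin n → ℤ) (a : Fin (n - S.k + 1)) : ℤ :=
  if (S.f a).1 = S.r then ∑ u ∈ nestVtx t N, ω u else ω (S.f a).1

/-- The weight on the subtree. -/
def subWeight (ω : Fin n → ℤ) (b : Fin S.k) : ℤ := ω (S.e b).1

theorem sum_proj_eq (ω : Fin n → ℤ) (a : Fin (n - S.k + 1)) :
    ∑ u with S.proj u = a, ω u = S.conWeight ω a := by
  have h : ∀ u, S.proj u = a ↔ (if u ∈ nestVtx t N then S.r else u) = (S.f a).1 := by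
    intro u
    rw [← f_proj, Subtype.val_inj, S.f.injective.eq_iff]
  simp only [h, conWeight]
  split_ifs with hr
  · refine Finset.sum_congr ?_ fun _ _ => rfl
    ext u
    by_cases hu : u ∈ nestVtx t N
    · simp [hu, hr]
    · have : u ≠ S.r := fun h' => hu (h' ▸ S.r_mem)
      simp [hu, hr, this]
  · rw [Finset.sum_eq_single_of_mem (S.f a).1]
    · have h3 := (S.f a).2
      simp only [Finset.mem_insert, hr, Finset.mem_sdiff, false_or] at h3
      simp [h3.2]
    · intro u hu hne
      simp only [Finset.mem_filter] at hu
      have := hu.2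
      split_ifs at this
      · exact absurd this.symm hr
      · exact absurd this hne

section Points

variable {α : Type*} [LinearOrder α] {c : Fin (n - 1) → α}

theorem orderPoint_inr (hc : N ∈ cutNests t c) (ω : Fin n → ℤ) (b : Fin (S.k - 1)) :
    orderPoint t ω c (S.σ (Sum.inr b)) =
      orderPoint S.sub (S.subWeight ω) (fun b => c (S.σ (Sum.inr b))) b := by
  rw [mem_cutNests] at hc
  have hN := hc.1.connected
  have hmem : ∀ u v, isAnc t (childV (S.σ (Sum.inr b))) u →
      ¬ isAnc t (childV (S.σ (Sum.inr b))) v →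
      (∀ j ∈ pathEdges t u v, c j ≤ c (S.σ (Sum.inr b))) →
      u ∈ nestVtx t N ∧ v ∈ nestVtx t N := by
    intro u v hu hv hmax
    refine mem_nestVtx_of_pathEdges_subset (fun h => hv (h ▸ hu)) fun j hj => ?_
    by_contra hjN
    have hb : S.σ (Sum.inr b) ∈ pathEdges t u v := mem_pathEdges.2 (by tauto)
    obtain ⟨e, he, heN, f, -, hfN, hadj⟩ :=
      (edgeConnected_pathEdges u v).exists_crossing hb (S.inr_mem hN b) hj hjN
    exact (hc.2 e heN f hfN hadj _ (S.inr_mem hN b)).not_ge (hmax e he)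
  have hsum : ∀ F : Fin n → ℝ, (∀ u, u ∉ nestVtx t N → F u = 0) →
      ∑ u, F u = ∑ x, F (S.e x).1 := by
    intro F hF
    rw [← Finset.sum_subset (Finset.subset_univ (nestVtx t N)) fun u _ => hF u,
      ← Finset.sum_coe_sort]
    exact (S.e.toEquiv.sum_comp fun u => F u.1).symm
  simp only [orderPoint]
  rw [hsum]
  · refine Finset.sum_congr rfl fun x _ => ?_
    rw [hsum]
    · refine Finset.sum_congr rfl fun y _ => if_congr ?_ rfl rfl
      rw [S.childV_inr, S.sub_isAnc, S.sub_isAnc]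
      refine and_congr_right fun _ => and_congr_right fun _ => ?_
      constructor
      · intro h b' hb'
        exact h _ ((S.mem_pathEdges_sub b' x y).1 hb')
      · intro h j hj
        obtain ⟨b', rfl⟩ := S.exists_inr (pathEdges_subset hN (S.e x).2 (S.e y).2 hj)
        exact h b' ((S.mem_pathEdges_sub b' x y).2 hj)
    · exact fun v hv => if_neg fun h => hv (hmem _ v h.1 h.2.1 h.2.2).2
  · exact fun u hu => Finset.sum_eq_zero fun v _ => if_neg fun h =>
      hu (hmem u v h.1 h.2.1 h.2.2).1

theorem orderPoint_inl (hc : N ∈ cutNests t c) (ω : Fin n → ℤ) (a : Fin (n - S.k)) :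
    orderPoint t ω c (S.σ (Sum.inl a)) =
      orderPoint S.con (S.conWeight ω) (fun a => c (S.σ (Sum.inl a))) a := by
  rw [mem_cutNests] at hc
  have hN := hc.1.connected
  have hmax : ∀ u v, isAnc t (childV (S.σ (Sum.inl a))) u →
      ¬ isAnc t (childV (S.σ (Sum.inl a))) v →
      ((∀ j ∈ pathEdges t u v, c j ≤ c (S.σ (Sum.inl a))) ↔
        ∀ a' ∈ pathEdges S.con (S.proj u) (S.proj v), c (S.σ (Sum.inl a')) ≤
          c (S.σ (Sum.inl a))) := by
    intro u v hu hv
    constructor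
    · intro h a' ha'
      exact h _ ((S.mem_pathEdges_con hN a' u v).1 ha')
    · intro h j hj
      have hout : ∀ j ∈ pathEdges t u v, j ∉ N → c j ≤ c (S.σ (Sum.inl a)) := by
        intro j hj hjN
        obtain ⟨a' | b, rfl⟩ := S.σ.surjective j
        · exact h a' ((S.mem_pathEdges_con hN a' u v).2 hj)
        · exact absurd (S.inr_mem hN b) hjN
      by_cases hjN : j ∈ N
      · have ha : S.σ (Sum.inl a) ∈ pathEdges t u v := mem_pathEdges.2 (by tauto)
        obtain ⟨e, he, heN, f, -, hfN, hadj⟩ :=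
          (edgeConnected_pathEdges u v).exists_crossing hj hjN ha (S.inl_notMem a)
        exact (hc.2 e heN f hfN hadj j hjN).le.trans (hout e he heN)
      · exact hout j hj hjN
  let G : Fin (n - S.k + 1) → Fin (n - S.k + 1) → ℝ := fun x y =>
    if isAnc S.con (childV (n := n - S.k + 1) a) x ∧
      ¬ isAnc S.con (childV (n := n - S.k + 1) a) y ∧
      ∀ a' ∈ pathEdges S.con x y, c (S.σ (Sum.inl a')) ≤ c (S.σ (Sum.inl a)) then 1 else 0
  have hl : orderPoint t ω c (S.σ (Sum.inl a)) =
      ∑ u, ∑ v, (ω u : ℝ) * ω v * G (S.proj u) (S.proj v) := by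
    refine Finset.sum_congr rfl fun u _ => Finset.sum_congr rfl fun v _ => ?_
    simp only [G, mul_ite, mul_one, mul_zero, S.isAnc_proj hN, ← S.childV_inl]
    refine if_congr ?_ rfl rfl
    exact and_congr_right fun hu => and_congr_right fun hv => hmax u v hu hv
  have hr : orderPoint S.con (S.conWeight ω) (fun a => c (S.σ (Sum.inl a))) a =
      ∑ x, ∑ y, (S.conWeight ω x : ℝ) * S.conWeight ω y * G x y := by
    refine Finset.sum_congr rfl fun u _ => Finset.sum_congr rfl fun v _ => ?_
    simp only [G, mul_ite, mul_one, mul_zero]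
  have hw : ∀ F : Fin (n - S.k + 1) → ℝ,
      ∑ u, (ω u : ℝ) * F (S.proj u) = ∑ x, (S.conWeight ω x : ℝ) * F x := by
    intro F
    rw [← Finset.sum_fiberwise _ S.proj]
    refine Finset.sum_congr rfl fun x _ => ?_
    rw [← S.sum_proj_eq, Int.cast_sum, Finset.sum_mul]
    exact Finset.sum_congr rfl fun u hu => by rw [(Finset.mem_filter.1 hu).2]
  rw [hl, hr]
  simp only [mul_assoc, ← Finset.mul_sum]
  simp only [hw]
  exact hw fun x => ∑ y, (S.conWeight ω y : ℝ) * G x y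

end Points

end NestSplit

namespace NestSplit

variable {n : ℕ} {t : PTree n} {N : Finset (Fin (n - 1))} (S : NestSplit t N)
  {ω : Fin n → ℤ}

theorem two_le_k (hn : 2 ≤ n) (hN : IsNest t N) : 2 ≤ S.k := by
  obtain ⟨i, hi⟩ := hN.nonempty hn
  rw [← S.card_eq]
  refine Finset.one_lt_card.2 ⟨_, childV_mem_nestVtx hi, _, parent_mem_nestVtx hi, fun h => ?_⟩
  have := parent_childV_lt t i
  rw [← h] at this
  exact lt_irrefl _ this

theorem k_lt (hN : EdgeConnected t N) (hne : N ≠ Finset.univ) : S.k < n := by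
  by_contra hk
  have hV : nestVtx t N = Finset.univ := by
    refine Finset.eq_univ_of_card _ (le_antisymm (Finset.card_le_univ _) ?_)
    rw [S.card_eq, Fintype.card_fin]
    exact not_lt.1 hk
  refine hne (Finset.eq_univ_of_forall fun i => ?_)
  exact pathEdges_subset hN (hV ▸ Finset.mem_univ (childV i))
    (hV ▸ Finset.mem_univ (t.parent (childV i))) (mem_pathEdges_parent.2 rfl)

theorem conWeight_pos (hω : ∀ j, 0 < ω j) (a : Fin (n - S.k + 1)) : 0 < S.conWeight ω a := by
  rw [conWeight]
  split_ifs
  · exact Finset.sum_pos (fun u _ => hω u) ⟨_, S.r_mem⟩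
  · exact hω _

theorem subWeight_pos (hω : ∀ j, 0 < ω j) (b : Fin S.k) : 0 < S.subWeight ω b := hω _

/-- The coordinate permutation induced by the shuffle. -/
def glue : (Vec (n - S.k) × Vec (S.k - 1)) →ₗ[ℝ] Vec (n - 1) where
  toFun p j := Sum.elim p.1 p.2 (S.σ.symm j)
  map_add' p q := by
    funext j
    rcases h : S.σ.symm j with a | b <;> simp [h]
  map_smul' s p := by
    funext j
    rcases h : S.σ.symm j with a | b <;> simp [h]

theorem glue_apply (p : Vec (n - S.k) × Vec (S.k - 1)) (j : Fin (n - 1)) :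
    S.glue p j = Sum.elim p.1 p.2 (S.σ.symm j) := rfl

theorem glue_eq_iff {p : Vec (n - S.k) × Vec (S.k - 1)} {w : Vec (n - 1)} :
    S.glue p = w ↔ p = (fun a => w (S.σ (Sum.inl a)), fun b => w (S.σ (Sum.inr b))) := by
  constructor
  · rintro rfl
    ext i <;> simp [glue_apply]
  · rintro rfl
    funext j
    obtain ⟨a | b, rfl⟩ := S.σ.surjective j <;> simp [glue_apply]

theorem mem_image_glue {A : Set (Vec (n - S.k))} {B : Set (Vec (S.k - 1))} {w : Vec (n - 1)} :
    w ∈ S.glue '' (A ×ˢ B) ↔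
      (fun a => w (S.σ (Sum.inl a))) ∈ A ∧ (fun b => w (S.σ (Sum.inr b))) ∈ B := by
  simp only [Set.mem_image, S.glue_eq_iff, exists_eq_right, Set.mem_prod]

theorem dot_glue (c : Vec (n - 1)) (p : Vec (n - S.k) × Vec (S.k - 1)) :
    dot c (S.glue p) = dot (fun a => c (S.σ (Sum.inl a))) p.1 +
      dot (fun b => c (S.σ (Sum.inr b))) p.2 := by
  simp only [dot]
  rw [← S.σ.sum_comp, Fintype.sum_sum_type]
  simp [glue_apply]

theorem faceOfNesting_eq_image_glue (hn : 2 ≤ n) (hN : IsNest t N) (hne : N ≠ Finset.univ) :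
    faceOfNesting t ω {Finset.univ, N} =
      S.glue '' (Loday S.con (S.conWeight ω) ×ˢ Loday S.sub (S.subWeight ω)) := by
  have hk := S.two_le_k hn hN
  have hk' := S.k_lt hN.connected hne
  rw [faceOfNesting_eq hn, Loday_eq (by omega), Loday_eq hk]
  refine Eq.trans ?_ ((congrArg (S.glue '' ·) (convexHull_prod _ _).symm).trans
    (LinearMap.image_convexHull S.glue _)).symm
  congr 1
  ext w
  rw [mem_image_glue]
  constructor
  · rintro ⟨c, hc, hcut, rfl⟩
    have hNc : N ∈ cutNests t c := hcut (by simp)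
    refine ⟨⟨fun a => c (S.σ (Sum.inl a)), ?_, ?_⟩, fun b => c (S.σ (Sum.inr b)), ?_, ?_⟩
    · exact hc.comp (S.σ.injective.comp Sum.inl_injective)
    · exact funext fun a => S.orderPoint_inl hNc ω a
    · exact hc.comp (S.σ.injective.comp Sum.inr_injective)
    · exact funext fun b => S.orderPoint_inr hNc ω b
  · rintro ⟨⟨c₁, hc₁, h₁⟩, c₂, hc₂, h₂⟩
    obtain ⟨B, hB⟩ : ∃ B, ∀ b, c₂ b < B :=
      ⟨Finset.univ.sup c₂ + 1, fun b => Nat.lt_succ_of_le (Finset.le_sup (Finset.mem_univ b))⟩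
    let c : Fin (n - 1) → ℕ := fun j => Sum.elim (fun a : Fin (n - S.k) => c₁ a + B) c₂
      (S.σ.symm j)
    have hcl : ∀ a : Fin (n - S.k), c (S.σ (Sum.inl a)) = c₁ a + B := by simp [c]
    have hcr : ∀ b, c (S.σ (Sum.inr b)) = c₂ b := by simp [c]
    have hc : Function.Injective c := by
      refine Function.Injective.comp (Function.Injective.sumElim ?_ hc₂ ?_) S.σ.symm.injective
      · exact fun a a' h => hc₁ (Nat.add_right_cancel h)
      · intro a b
        have := hB b
        omega
    have hNc : N ∈ cutNests t c := by
      refine mem_cutNests.2 ⟨hN, fun e he _ _ _ g hg => ?_⟩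
      obtain ⟨b, rfl⟩ := S.exists_inr hg
      obtain ⟨a | b', rfl⟩ := S.σ.surjective e
      · rw [hcl, hcr]
        have := hB b
        omega
      · exact absurd (S.inr_mem hN.connected b') he
    refine ⟨c, hc, ?_, ?_⟩
    · intro M hM
      rw [Finset.mem_insert, Finset.mem_singleton] at hM
      rcases hM with rfl | rfl
      · exact (isNesting_cutNests hn c).2.1
      · exact hNc
    · funext j
      obtain ⟨a | b, rfl⟩ := S.σ.surjective j
      · rw [S.orderPoint_inl hNc]
        have hord : ∀ i j : Fin (n - S.k),
            c₁ i ≤ c₁ j ↔ c (S.σ (Sum.inl i)) ≤ c (S.σ (Sum.inl j)) := fun i j => by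
          rw [hcl, hcl, Nat.add_le_add_iff_right]
        exact (congrFun h₁ a).trans (congrFun (orderPoint_congr (t := S.con) hord) a)
      · rw [S.orderPoint_inr hNc]
        have hord : ∀ i j, c₂ i ≤ c₂ j ↔ c (S.σ (Sum.inr i)) ≤ c (S.σ (Sum.inr j)) :=
          fun i j => by rw [hcr, hcr]
        exact (congrFun h₂ b).trans (congrFun (orderPoint_congr hord) b)

theorem exists_faceOfNesting_eq (hn : 2 ≤ n) (hω : ∀ j, 0 < ω j) (hN : IsNest t N)
    (hne : N ≠ Finset.univ) {𝒩 : Finset (Finset (Fin (n - 1)))} (h : IsNesting t 𝒩)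
    (hmem : N ∈ 𝒩) : ∃ 𝒩₁ 𝒩₂, IsNesting S.con 𝒩₁ ∧ IsNesting S.sub 𝒩₂ ∧
      faceOfNesting t ω 𝒩 = S.glue '' (faceOfNesting S.con (S.conWeight ω) 𝒩₁ ×ˢ
        faceOfNesting S.sub (S.subWeight ω) 𝒩₂) := by
  have hk := S.two_le_k hn hN
  have hk' := S.k_lt hN.connected hne
  let c := nestingFunctional 𝒩
  let c₁ : Vec (n - S.k + 1 - 1) := fun a => c (S.σ (Sum.inl a))
  let c₂ : Vec (S.k - 1) := fun b => c (S.σ (Sum.inr b))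
  refine ⟨cutNests S.con c₁, cutNests S.sub c₂, isNesting_cutNests (by omega) c₁,
    isNesting_cutNests hk c₂, ?_⟩
  have hface : faceOfNesting t ω 𝒩 = {x ∈ Loday t ω | ∀ y ∈ Loday t ω, dot c y ≤ dot c x} := by
    rw [sep_max_Loday hn hω, cutNests_nestingFunctional hn h]
  have hle : faceOfNesting t ω 𝒩 ⊆ faceOfNesting t ω {Finset.univ, N} :=
    faceOfNesting_anti (by
      rw [Finset.insert_subset_iff, Finset.singleton_subset_iff]
      exact ⟨h.2.1, hmem⟩)
  have hle' : faceOfNesting t ω {Finset.univ, N} ⊆ Loday t ω := by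
    rw [Loday_eq_faceOfNesting]
    exact faceOfNesting_anti (by simp)
  have hmax : faceOfNesting t ω 𝒩 = {x ∈ faceOfNesting t ω {Finset.univ, N} |
      ∀ y ∈ faceOfNesting t ω {Finset.univ, N}, dot c y ≤ dot c x} := by
    refine Set.Subset.antisymm (fun x hx => ⟨hle hx, fun y hy => ?_⟩) fun x hx => ?_
    · rw [hface] at hx
      exact hx.2 y (hle' hy)
    · obtain ⟨z, hz⟩ := faceOfNesting_nonempty (ω := ω) hn h
      have hzx := hx.2 z (hle hz)
      rw [hface] at hz ⊢
      exact ⟨hle' hx.1, fun y hy => (hz.2 y hy).trans hzx⟩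
  rw [hmax, ← sep_max_Loday (by omega) (S.conWeight_pos hω), ← sep_max_Loday hk (S.subWeight_pos hω),
    S.faceOfNesting_eq_image_glue hn hN hne]
  refine Set.Subset.antisymm ?_ ?_
  · rintro _ ⟨⟨⟨p, q⟩, ⟨hp, hq⟩, rfl⟩, hpq⟩
    refine ⟨(p, q), ⟨⟨hp, fun p' hp' => ?_⟩, hq, fun q' hq' => ?_⟩, rfl⟩
    · have := hpq _ ⟨(p', q), ⟨hp', hq⟩, rfl⟩
      rw [dot_glue, dot_glue] at this
      exact le_of_add_le_add_right this
    · have := hpq _ ⟨(p, q'), ⟨hp, hq'⟩, rfl⟩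
      rw [dot_glue, dot_glue] at this
      exact le_of_add_le_add_left this
  · rintro _ ⟨⟨p, q⟩, ⟨⟨hp, hp'⟩, hq, hq'⟩, rfl⟩
    refine ⟨⟨(p, q), ⟨hp, hq⟩, rfl⟩, ?_⟩
    rintro _ ⟨⟨p', q'⟩, ⟨hpm, hqm⟩, rfl⟩
    rw [dot_glue, dot_glue]
    exact add_le_add (hp' p' hpm) (hq' q' hqm)

end NestSplit

theorem facetProduct {n : ℕ} (hn : 2 ≤ n) {t : PTree n} (ω : Fin n → ℤ)
    {N : Finset (Fin (n - 1))} (hN : IsNest t N) (hne : N ≠ Finset.univ) :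
    FacetProduct t ω N := by
  obtain ⟨S⟩ := nonempty_nestSplit hn hN
  refine ⟨S.k, S.r, S.card_eq, S.r_mem, S.r_le, S.sub, S.con, S.e, S.f, S.σ, S.sub_parent,
    S.con_parent, fun b => congrArg Fin.val (S.childV_inr b),
    fun a => congrArg Fin.val (S.childV_inl a), ?_⟩
  rw [S.faceOfNesting_eq_image_glue hn hN hne]
  ext w
  constructor
  · rintro ⟨⟨x, y⟩, ⟨hx, hy⟩, rfl⟩
    exact ⟨x, y, hx, hy, rfl⟩
  · rintro ⟨x, y, hx, hy, rfl⟩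
    exact ⟨(x, y), ⟨hx, hy⟩, rfl⟩

/-- A set is, up to a permutation of coordinates, a product of Loday realizations of trees with
at most `B` vertices. -/
def IsLodayProduct (B : ℕ) {d : ℕ} (F : Set (Vec d)) : Prop :=
  ∃ (ι : Type) (_ : Fintype ι) (dims : ι → ℕ) (trees : ∀ j, PTree (dims j))
    (ωs : ∀ j, Fin (dims j) → ℤ) (σ : (Σ j : ι, Fin (dims j - 1)) ≃ Fin d),
    (∀ j, dims j ≤ B) ∧ (∀ j i, 0 < ωs j i) ∧
      ∀ w, w ∈ F ↔ ∀ j, (fun i => w (σ ⟨j, i⟩)) ∈ Loday (trees j) (ωs j)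

theorem IsLodayProduct.mono {B B' d : ℕ} (hB : B ≤ B') {F : Set (Vec d)}
    (h : IsLodayProduct B F) : IsLodayProduct B' F := by
  obtain ⟨ι, _, dims, trees, ωs, σ, h₁, h₂⟩ := h
  exact ⟨ι, inferInstance, dims, trees, ωs, σ, fun j => (h₁ j).trans hB, h₂⟩

theorem isLodayProduct_Loday {n : ℕ} (t : PTree n) {ω : Fin n → ℤ} (hω : ∀ j, 0 < ω j) :
    IsLodayProduct n (Loday t ω) :=
  ⟨Unit, inferInstance, fun _ => n, fun _ => t, fun _ => ω, Equiv.uniqueSigma _,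
    fun _ => le_rfl, fun _ => hω, fun _ => (forall_const Unit).symm⟩

theorem IsLodayProduct.prod {B d₁ d₂ d : ℕ} {F₁ : Set (Vec d₁)} {F₂ : Set (Vec d₂)}
    {F : Set (Vec d)} (h₁ : IsLodayProduct B F₁) (h₂ : IsLodayProduct B F₂)
    (τ : Fin d₁ ⊕ Fin d₂ ≃ Fin d) (hF : ∀ w, w ∈ F ↔
      (fun a => w (τ (Sum.inl a))) ∈ F₁ ∧ (fun b => w (τ (Sum.inr b))) ∈ F₂) :
    IsLodayProduct B F := by
  obtain ⟨ι₁, _, dims₁, trees₁, ωs₁, σ₁, hB₁, hω₁, h₁⟩ := h₁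
  obtain ⟨ι₂, _, dims₂, trees₂, ωs₂, σ₂, hB₂, hω₂, h₂⟩ := h₂
  refine ⟨ι₁ ⊕ ι₂, inferInstance, Sum.elim dims₁ dims₂,
    fun j => Sum.rec (motive := fun j => PTree (Sum.elim dims₁ dims₂ j)) trees₁ trees₂ j,
    fun j => Sum.rec (motive := fun j => Fin (Sum.elim dims₁ dims₂ j) → ℤ) ωs₁ ωs₂ j,
    (Equiv.sumSigmaDistrib _).trans ((Equiv.sumCongr σ₁ σ₂).trans τ), ?_, ?_, ?_⟩
  · rintro (j | j)
    exacts [hB₁ j, hB₂ j]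
  · rintro (j | j)
    exacts [hω₁ j, hω₂ j]
  · intro w
    rw [hF, h₁, h₂, Sum.forall]
    rfl

theorem isLodayProduct_faceOfNesting_of_ne {n : ℕ} (hn : 2 ≤ n)
    (ih : ∀ m < n, 2 ≤ m → ∀ (t : PTree m) (ω : Fin m → ℤ), (∀ j, 0 < ω j) →
      ∀ 𝒩, IsNesting t 𝒩 → IsLodayProduct m (faceOfNesting t ω 𝒩))
    (t : PTree n) {ω : Fin n → ℤ} (hω : ∀ j, 0 < ω j) {𝒩 : Finset (Finset (Fin (n - 1)))}
    (h : IsNesting t 𝒩) (hne : 𝒩 ≠ {Finset.univ}) :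
    IsLodayProduct (n - 1) (faceOfNesting t ω 𝒩) := by
  obtain ⟨N, hmem, hN⟩ : ∃ N ∈ 𝒩, N ≠ Finset.univ := by
    by_contra! hall
    exact hne (Finset.eq_singleton_iff_unique_mem.2 ⟨h.2.1, hall⟩)
  have hnest := h.1 N hmem
  obtain ⟨S⟩ := nonempty_nestSplit hn hnest
  have hk := S.two_le_k hn hnest
  have hk' := S.k_lt hnest.connected hN
  obtain ⟨𝒩₁, 𝒩₂, h₁, h₂, heq⟩ := S.exists_faceOfNesting_eq hn hω hnest hN h hmem
  rw [heq]
  exact ((ih _ (by omega) (by omega) _ _ (S.conWeight_pos hω) _ h₁).mono (by omega)).prod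
    ((ih _ (by omega) hk _ _ (S.subWeight_pos hω) _ h₂).mono (by omega)) S.σ
    fun w => S.mem_image_glue

theorem isLodayProduct_faceOfNesting {n : ℕ} (hn : 2 ≤ n) (t : PTree n) (ω : Fin n → ℤ)
    (hω : ∀ j, 0 < ω j) (𝒩 : Finset (Finset (Fin (n - 1)))) (h : IsNesting t 𝒩) :
    IsLodayProduct n (faceOfNesting t ω 𝒩) := by
  induction n using Nat.strong_induction_on with
  | _ n ih =>
    by_cases hne : 𝒩 = {Finset.univ}
    · rw [hne, ← Loday_eq_faceOfNesting]
      exact isLodayProduct_Loday t hω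
    · exact (isLodayProduct_faceOfNesting_of_ne hn ih t hω h hne).mono (Nat.sub_le n 1)

theorem productDecomp {n : ℕ} (hn : 2 ≤ n) (t : PTree n) {ω : Fin n → ℤ} (hω : ∀ j, 0 < ω j)
    {𝒩 : Finset (Finset (Fin (n - 1)))} (h : IsNesting t 𝒩) (hne : 𝒩 ≠ {Finset.univ}) :
    ProductDecomp t ω 𝒩 := by
  obtain ⟨ι, _, dims, trees, ωs, σ, hB, hpos, hF⟩ := isLodayProduct_faceOfNesting_of_ne hn
    (fun m _ hm => isLodayProduct_faceOfNesting hm) t hω h hne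
  let g := (Fintype.equivFin ι).symm
  refine ⟨Fintype.card ι, fun j => dims (g j), fun j => trees (g j), fun j => ωs (g j),
    (Equiv.sigmaCongrLeft (β := fun j => Fin (dims j - 1)) g).trans σ,
    fun j => (hB _).trans_lt (by omega), fun j => hpos _, ?_⟩
  ext w
  rw [hF, g.surjective.forall]
  constructor
  · intro hw
    refine ⟨fun j i => w (σ ⟨g j, i⟩), hw, funext fun i => ?_⟩
    obtain ⟨⟨j, i⟩, rfl⟩ := (Equiv.sigmaCongrLeft (β := fun j => Fin (dims j - 1)) g).trans σ
      |>.surjective i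
    rw [Equiv.symm_apply_apply]
    rfl
  · rintro ⟨x, hx, rfl⟩ j
    convert hx j using 1
    funext i
    have : σ ⟨g j, i⟩ =
      (Equiv.sigmaCongrLeft (β := fun j => Fin (dims j - 1)) g).trans σ ⟨j, i⟩ := rfl
    rw [this]
    beta_reduce
    rw [Equiv.symm_apply_apply]

/-- (a) The face lattice of the Loday realization `P_{(t,ω)}` is isomorphic to
the dual of the lattice of nestings of `t`: the assignment `𝒩 ↦ conv{M(t,𝒩',ω) : 𝒩' ⊇ 𝒩}` is
an order-reversing bijection from nestings onto nonempty faces, the face of `𝒩` having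
codimension `𝒩.card - 1` (i.e. dimension `n - 1 - 𝒩.card`).  (b) The facet corresponding to a
unique nontrivial nest `N` is the image of `P_{(t̄,ω̄)} × P_{(t̃,ω̃)}` under the coordinate
permutation induced by the shuffle `σ_N`; hence every proper face of a Loday realization is
isomorphic, via a permutation of coordinates, to a product of Loday realizations of lower
dimension. -/
theorem stmt14 {n : ℕ} (hn : 2 ≤ n) (t : PTree n) (ω : Fin n → ℤ) (hω : ∀ j, 0 < ω j) :
    (∀ 𝒩, IsNesting t 𝒩 →
      IsFace (Loday t ω) (faceOfNesting t ω 𝒩) ∧ (faceOfNesting t ω 𝒩).Nonempty ∧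
      sdim (faceOfNesting t ω 𝒩) + 𝒩.card = n - 1) ∧
    (∀ 𝒩 𝒩', IsNesting t 𝒩 → IsNesting t 𝒩' →
      (faceOfNesting t ω 𝒩 ⊆ faceOfNesting t ω 𝒩' ↔ 𝒩' ⊆ 𝒩)) ∧
    (∀ F, IsFace (Loday t ω) F → F.Nonempty →
      ∃ 𝒩, IsNesting t 𝒩 ∧ F = faceOfNesting t ω 𝒩) ∧
    (∀ N : Finset (Fin (n - 1)), IsNest t N → N ≠ Finset.univ → FacetProduct t ω N) ∧
    (∀ 𝒩, IsNesting t 𝒩 → 𝒩 ≠ {Finset.univ} → ProductDecomp t ω 𝒩) := by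
  refine ⟨fun 𝒩 h => ⟨isFace_faceOfNesting hn hω h, faceOfNesting_nonempty hn h,
    sdim_faceOfNesting hn hω h⟩, fun 𝒩 𝒩' h h' => faceOfNesting_subset_iff hn hω h h',
    fun F hF _ => exists_eq_faceOfNesting hn hω hF, fun N hN hne => facetProduct hn ω hN hne,
    fun 𝒩 h hne => productDecomp hn t hω h hne⟩
end
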